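/- arXiv:1301.4603 — 5 statements merged into one kernel-verified Lean document; each statement's English description precedes it below -/
import Mathlib

section
/- Let T = [A,B,C]_R with A ∈ F^{I×R}, B ∈ F^{J×R}, C ∈ F^{K×R}, and set m_C := R − r_C + 2. Assume: (i) max(min(k_A, k_B − 1), min(k_A − 1, k_B)) + k_C ≥ R + 1; (ii) the matrix C_{m_C}(A)⊙C_{m_C}(B) has full column rank. Then r_T = R and the CPD of T is unique. -/
open scoped Matrix
open MeasureTheory

variable {F : Type*} [RCLike F]

/-- The k-rank of a matrix: the largest `k` such that every subset of `k` columns is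
linearly independent. -/
noncomputable def krank {I R : ℕ} (A : Matrix (Fin I) (Fin R) F) : ℕ :=
  sSup {k | k ≤ R ∧ ∀ s : Finset (Fin R), s.card = k →
    LinearIndependent F (fun r : {x // x ∈ s} => A.transpose r.1)}

/-- The tensor `[A,B,C]_R` with entries `t_{ijk} = ∑ r, a_r(i) b_r(j) c_r(k)`. -/
def pdTensor {I J K R : ℕ} (A : Matrix (Fin I) (Fin R) F) (B : Matrix (Fin J) (Fin R) F)
    (C : Matrix (Fin K) (Fin R) F) : Fin I → Fin J → Fin K → F :=
  fun i j k => ∑ r, A i r * B j r * C k r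

/-- `T = [A,B,C]_R` is a polyadic decomposition of `T` (columns are required nonzero). -/
def IsPD {I J K R : ℕ} (T : Fin I → Fin J → Fin K → F) (A : Matrix (Fin I) (Fin R) F)
    (B : Matrix (Fin J) (Fin R) F) (C : Matrix (Fin K) (Fin R) F) : Prop :=
  (∀ r, A.transpose r ≠ 0) ∧ (∀ r, B.transpose r ≠ 0) ∧ (∀ r, C.transpose r ≠ 0) ∧
    T = pdTensor A B C

/-- The rank of a tensor: the minimal number of rank-1 terms in a PD. -/
noncomputable def tensorRank {I J K : ℕ} (T : Fin I → Fin J → Fin K → F) : ℕ :=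
  sInf {R | ∃ A : Matrix (Fin I) (Fin R) F, ∃ B : Matrix (Fin J) (Fin R) F,
    ∃ C : Matrix (Fin K) (Fin R) F, IsPD T A B C}

/-- The CPD of `T` (with `R` terms) is (essentially) unique: any two PDs with `R` terms
coincide up to permutation and scaling. -/
def CPDUnique {I J K : ℕ} (T : Fin I → Fin J → Fin K → F) (R : ℕ) : Prop :=
  ∀ (A A' : Matrix (Fin I) (Fin R) F) (B B' : Matrix (Fin J) (Fin R) F)
    (C C' : Matrix (Fin K) (Fin R) F), IsPD T A B C → IsPD T A' B' C' →
    ∃ σ : Equiv.Perm (Fin R), ∃ la lb lc : Fin R → F,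
      (∀ r, la r * lb r * lc r = 1) ∧
      (∀ i r, A' i r = A i (σ r) * la r) ∧
      (∀ j r, B' j r = B j (σ r) * lb r) ∧
      (∀ k r, C' k r = C k (σ r) * lc r)

/-- The third factor matrix of `T` (with `R` terms) is (essentially) unique. -/
def ThirdFactorUnique {I J K : ℕ} (T : Fin I → Fin J → Fin K → F) (R : ℕ) : Prop :=
  ∀ (A A' : Matrix (Fin I) (Fin R) F) (B B' : Matrix (Fin J) (Fin R) F)
    (C C' : Matrix (Fin K) (Fin R) F), IsPD T A B C → IsPD T A' B' C' →
    ∃ σ : Equiv.Perm (Fin R), ∃ lc : Fin R → F, (∀ r, lc r ≠ 0) ∧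
      (∀ k r, C' k r = C k (σ r) * lc r)

/-- The `m`-th compound matrix: the matrix of all `m × m` minors of `A`, with rows and
columns indexed by the `m`-element index subsets (taken in increasing order). -/
noncomputable def compound {I R : ℕ} (m : ℕ) (A : Matrix (Fin I) (Fin R) F) :
    Matrix {s : Finset (Fin I) // s.card = m} {t : Finset (Fin R) // t.card = m} F :=
  fun s t => Matrix.det (Matrix.of fun i j : Fin m =>
    A (s.1.orderIsoOfFin s.2 i).1 (t.1.orderIsoOfFin t.2 j).1)

/-- Khatri–Rao (column-wise Kronecker) product. -/
def khatriRao {α β γ : Type*} (A : Matrix α γ F) (B : Matrix β γ F) : Matrix (α × β) γ F :=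
  fun p c => A p.1 c * B p.2 c

/-- A matrix has full column rank iff its columns are linearly independent. -/
def FullColRank {α γ : Type*} (M : Matrix α γ F) : Prop :=
  LinearIndependent F M.transpose

/-- The vector `d̂^(m)` of all products `d_{i₁} ⋯ d_{i_m}`, `i₁ < ⋯ < i_m`. -/
def hatVec {R : ℕ} (m : ℕ) (d : Fin R → F) : {t : Finset (Fin R) // t.card = m} → F :=
  fun t => ∏ i ∈ t.1, d i

/-- Condition (Um) for the pair `(A, B)`. -/
def CondU {I J R : ℕ} (m : ℕ) (A : Matrix (Fin I) (Fin R) F)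
    (B : Matrix (Fin J) (Fin R) F) : Prop :=
  ∀ d : Fin R → F,
    (khatriRao (compound m A) (compound m B)).mulVec (hatVec m d) = 0 → hatVec m d = 0

/-- Condition (Wm) for the triple `(A, B, C)`. -/
def CondW {I J K R : ℕ} (m : ℕ) (A : Matrix (Fin I) (Fin R) F)
    (B : Matrix (Fin J) (Fin R) F) (C : Matrix (Fin K) (Fin R) F) : Prop :=
  ∀ d : Fin R → F, (∃ x : Fin K → F, d = C.transpose.mulVec x) →
    (khatriRao (compound m A) (compound m B)).mulVec (hatVec m d) = 0 → hatVec m d = 0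

/-- Condition (Hm) for the pair `(A, B)`: `H_{AB}(δ) ≥ min(δ, m)` for `δ = 1, …, R`. -/
def CondH {I J R : ℕ} (m : ℕ) (A : Matrix (Fin I) (Fin R) F)
    (B : Matrix (Fin J) (Fin R) F) : Prop :=
  ∀ δ : ℕ, 1 ≤ δ → δ ≤ R → ∀ s : Finset (Fin R), s.card = δ →
    δ + min δ m ≤ (A.submatrix id (fun x : {y // y ∈ s} => x.1)).rank +
      (B.submatrix id (fun x : {y // y ∈ s} => x.1)).rank

/-- Cauchy–Binet. -/
theorem aux_cauchy_binet {m R : ℕ} (M : Matrix (Fin m) (Fin R) F) (N : Matrix (Fin R) (Fin m) F) :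
    (M * N).det = ∑ t : {t : Finset (Fin R) // t.card = m},
      (M.submatrix id (fun j => (t.1.orderIsoOfFin t.2 j).1)).det *
      (N.submatrix (fun j => (t.1.orderIsoOfFin t.2 j).1) id).det := by
  classical
  have e1 : (M * N).det = ∑ p : Fin m → Fin R,
      (∏ i, N (p i) i) * (M.submatrix id p).det := by
    simp only [Matrix.det_apply', Matrix.mul_apply, Finset.prod_univ_sum, Finset.mul_sum,
      Fintype.piFinset_univ]
    rw [Finset.sum_comm]
    refine Finset.sum_congr rfl fun p _ => Finset.sum_congr rfl fun σ _ => ?_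
    simp only [Finset.prod_mul_distrib, Matrix.submatrix_apply, id]
    ring
  rw [e1]
  have e2 : ∀ t : {t : Finset (Fin R) // t.card = m},
      (M.submatrix id (fun j => (t.1.orderIsoOfFin t.2 j).1)).det *
      (N.submatrix (fun j => (t.1.orderIsoOfFin t.2 j).1) id).det =
      ∑ σ : Equiv.Perm (Fin m), (∏ i, N (t.1.orderIsoOfFin t.2 (σ i)).1 i) *
        (M.submatrix id (fun j => (t.1.orderIsoOfFin t.2 (σ j)).1)).det := by
    intro t
    have e3 : ∀ σ : Equiv.Perm (Fin m),
        (M.submatrix id (fun j => (t.1.orderIsoOfFin t.2 (σ j)).1)).det =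
        Equiv.Perm.sign σ * (M.submatrix id (fun j => (t.1.orderIsoOfFin t.2 j).1)).det := by
      intro σ
      rw [← Matrix.det_permute']
      rfl
    simp only [e3]
    rw [Matrix.det_apply' (N.submatrix _ _), Finset.mul_sum]
    refine Finset.sum_congr rfl fun σ _ => ?_
    simp only [Matrix.submatrix_apply, id]
    ring
  simp only [e2]
  rw [← Fintype.sum_prod_type']
  symm
  have key : ∀ (q : {t : Finset (Fin R) // t.card = m} × Equiv.Perm (Fin m)),
      Finset.univ.image (fun i => (q.1.1.orderIsoOfFin q.1.2 (q.2 i)).1) = q.1.1 := by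
    intro q
    ext x
    simp only [Finset.mem_image, Finset.mem_univ, true_and]
    constructor
    · rintro ⟨i, rfl⟩
      exact (q.1.1.orderIsoOfFin q.1.2 (q.2 i)).2
    · intro hx
      exact ⟨q.2.symm ((q.1.1.orderIsoOfFin q.1.2).symm ⟨x, hx⟩), by simp⟩
  refine Fintype.sum_of_injective
    (fun q : {t : Finset (Fin R) // t.card = m} × Equiv.Perm (Fin m) =>
      fun i => (q.1.1.orderIsoOfFin q.1.2 (q.2 i)).1) ?_ _ _ ?_ (fun q => rfl)
  · intro q q' h
    have h' : q.1 = q'.1 := by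
      apply Subtype.ext
      rw [← key q, ← key q']
      exact congrArg (fun f => Finset.univ.image f) h
    obtain ⟨t, σ⟩ := q
    obtain ⟨t', σ'⟩ := q'
    simp only at h'
    subst h'
    have : σ = σ' := by
      ext1 i
      have := congrFun h i
      simp only at this
      exact (t.1.orderIsoOfFin t.2).injective (Subtype.ext this)
    rw [this]
  · intro p hp
    by_cases hinj : Function.Injective p
    · exfalso
      apply hp
      have hc : (Finset.univ.image p).card = m := by
        rw [Finset.card_image_of_injective _ hinj]; simp
      let f : Fin m → Fin m := fun i =>
        ((Finset.univ.image p).orderIsoOfFin hc).symm ⟨p i, by simp⟩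
      have hf : Function.Injective f := by
        intro i j hij
        apply hinj
        have := ((Finset.univ.image p).orderIsoOfFin hc).symm.injective hij
        exact congrArg Subtype.val this
      refine ⟨(⟨Finset.univ.image p, hc⟩,
        Equiv.ofBijective f (Finite.injective_iff_bijective.mp hf)), ?_⟩
      funext i
      simp [f]
    · rw [Function.Injective] at hinj
      push Not at hinj
      obtain ⟨i, j, hij, hne⟩ := hinj
      rw [Matrix.det_zero_of_column_eq hne, mul_zero]
      intro k
      simp [hij]

/-- Rank below `m` forces all products of `m` weights to vanish. -/
theorem aux_weight {I J R m : ℕ} (A : Matrix (Fin I) (Fin R) F) (B : Matrix (Fin J) (Fin R) F)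
    (h2 : FullColRank (khatriRao (compound m A) (compound m B))) (d : Fin R → F)
    (hr : (A * Matrix.diagonal d * Bᵀ).rank < m) (t : Finset (Fin R)) (ht : t.card = m) :
    ∏ i ∈ t, d i = 0 := by
  classical
  have hz := Fintype.linearIndependent_iff.mp h2 (fun t => ∏ i ∈ t.1, d i) ?_ ⟨t, ht⟩
  · exact hz
  funext q
  obtain ⟨s, s'⟩ := q
  simp only [Finset.sum_apply, Pi.smul_apply, smul_eq_mul, Matrix.transpose_apply, khatriRao,
    Pi.zero_apply]
  let es : Fin m → Fin I := fun i => (s.1.orderIsoOfFin s.2 i).1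
  let es' : Fin m → Fin J := fun i => (s'.1.orderIsoOfFin s'.2 i).1
  have hd : ((A * Matrix.diagonal d * Bᵀ).submatrix es es').det = 0 := by
    by_contra hne
    have h3 : ((A * Matrix.diagonal d * Bᵀ).submatrix es es').rank = m := by
      rw [Matrix.rank_of_isUnit _ ((Matrix.isUnit_iff_isUnit_det _).mpr (isUnit_iff_ne_zero.mpr hne))]
      simp
    have h4 := Matrix.rank_submatrix_le (A * Matrix.diagonal d * Bᵀ) es es'
    omega
  have he : (A * Matrix.diagonal d * Bᵀ).submatrix es es' =
      A.submatrix es id * (Matrix.diagonal d * Bᵀ).submatrix id es' := by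
    rw [Matrix.mul_assoc]
    ext i j
    simp [Matrix.mul_apply]
  rw [he, aux_cauchy_binet] at hd
  rw [← hd]
  refine Finset.sum_congr rfl fun t _ => ?_
  have e1 : (((Matrix.diagonal d * Bᵀ).submatrix id es').submatrix
      (fun j => (t.1.orderIsoOfFin t.2 j).1) id) =
      Matrix.diagonal (fun j => d (t.1.orderIsoOfFin t.2 j).1) *
      (B.submatrix es' (fun j => (t.1.orderIsoOfFin t.2 j).1))ᵀ := by
    ext i j
    simp [Matrix.diagonal_mul]
  rw [e1, Matrix.det_mul, Matrix.det_diagonal, Matrix.det_transpose]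
  have e2 : ∏ j, d (t.1.orderIsoOfFin t.2 j).1 = ∏ i ∈ t.1, d i := by
    rw [← Finset.prod_coe_sort t.1]
    exact Fintype.prod_equiv (t.1.orderIsoOfFin t.2).toEquiv _ _ (fun _ => rfl)
  rw [e2]
  have e3 : compound m A s t = ((A.submatrix es id).submatrix id
    (fun j => (t.1.orderIsoOfFin t.2 j).1)).det := rfl
  have e4 : compound m B s' t = (B.submatrix es'
    (fun j => (t.1.orderIsoOfFin t.2 j).1)).det := rfl
  rw [e3, e4]
  ring

theorem aux_krank_mem {I R : ℕ} (A : Matrix (Fin I) (Fin R) F) :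
    krank A ≤ R ∧ ∀ s : Finset (Fin R), s.card = krank A →
    LinearIndependent F (fun r : {x // x ∈ s} => A.transpose r.1) := by
  have := Nat.sSup_mem (s := {k | k ≤ R ∧ ∀ s : Finset (Fin R), s.card = k →
    LinearIndependent F (fun r : {x // x ∈ s} => A.transpose r.1)})
    ⟨0, Nat.zero_le _, fun s hs => by
      rw [Finset.card_eq_zero] at hs
      subst hs
      exact linearIndependent_empty_type⟩ ⟨R, fun k hk => hk.1⟩
  exact this

theorem aux_krank_li {I R : ℕ} (A : Matrix (Fin I) (Fin R) F) (s : Finset (Fin R))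
    (hs : s.card ≤ krank A) :
    LinearIndependent F (fun r : {x // x ∈ s} => A.transpose r.1) := by
  obtain ⟨h1, h2⟩ := aux_krank_mem A
  obtain ⟨t, hst, -, ht⟩ := Finset.exists_subsuperset_card_eq (Finset.subset_univ s) hs
    (by simpa using h1)
  exact (h2 t ht).comp (fun r : {x // x ∈ s} => (⟨r.1, hst r.2⟩ : {x // x ∈ t}))
    (fun a b h => Subtype.ext (congrArg (fun x : {x // x ∈ t} => x.1) h))

theorem aux_krank_le_rank {I R : ℕ} (A : Matrix (Fin I) (Fin R) F) : krank A ≤ A.rank := by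
  obtain ⟨h1, h2⟩ := aux_krank_mem A
  obtain ⟨t, -, -, ht⟩ := Finset.exists_subsuperset_card_eq
    (Finset.subset_univ (∅ : Finset (Fin R))) (n := krank A) (by simp) (by simpa using h1)
  have hli := h2 t ht
  rw [Matrix.rank_eq_finrank_span_cols]
  have h3 := finrank_span_eq_card hli
  rw [Fintype.card_coe, ht] at h3
  rw [← h3]
  apply Submodule.finrank_mono
  apply Submodule.span_mono
  rintro _ ⟨r, rfl⟩
  exact ⟨r.1, rfl⟩

theorem aux_left_inv {I R : ℕ} (A : Matrix (Fin I) (Fin R) F) (s : Finset (Fin R))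
    (h : LinearIndependent F (fun r : {x // x ∈ s} => A.transpose r.1)) :
    ∃ P : Matrix {x // x ∈ s} (Fin I) F,
      P * A.submatrix id (fun r : {x // x ∈ s} => r.1) = 1 := by
  classical
  set M := A.submatrix id (fun r : {x // x ∈ s} => r.1) with hM
  have hinj : Function.Injective M.mulVec := Matrix.mulVec_injective_iff.mpr h
  obtain ⟨g, hg⟩ := LinearMap.exists_leftInverse_of_injective M.mulVecLin
    (LinearMap.ker_eq_bot.mpr hinj)
  refine ⟨LinearMap.toMatrix' g, ?_⟩
  have : LinearMap.toMatrix' (g ∘ₗ M.mulVecLin) = 1 := by rw [hg]; simp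
  rw [LinearMap.toMatrix'_comp] at this
  simpa [← Matrix.toLin'_apply'] using this

theorem aux_restrict {I J R : ℕ} (A : Matrix (Fin I) (Fin R) F) (B : Matrix (Fin J) (Fin R) F)
    (s : Finset (Fin R)) (d : Fin R → F) (hd : ∀ r, r ∉ s → d r = 0) :
    A * Matrix.diagonal d * Bᵀ = A.submatrix id (fun r : {x // x ∈ s} => r.1) *
      Matrix.diagonal (fun r : {x // x ∈ s} => d r.1) *
      (B.submatrix id (fun r : {x // x ∈ s} => r.1))ᵀ := by
  classical
  ext i j
  rw [Matrix.mul_apply, Matrix.mul_apply]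
  simp only [Matrix.mul_diagonal, Matrix.transpose_apply, Matrix.submatrix_apply, id]
  rw [Finset.sum_coe_sort s (fun r => A i r * d r * B j r)]
  symm
  apply Finset.sum_subset (Finset.subset_univ s)
  intro r _ hr
  simp [hd r hr]

theorem aux_rank_lower {I J R : ℕ} (A : Matrix (Fin I) (Fin R) F) (B : Matrix (Fin J) (Fin R) F)
    (s : Finset (Fin R)) (d : Fin R → F) (hd : ∀ r, r ∉ s → d r = 0) (hd' : ∀ r ∈ s, d r ≠ 0)
    (hA : s.card ≤ krank A) (hB : s.card ≤ krank B) :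
    s.card ≤ (A * Matrix.diagonal d * Bᵀ).rank := by
  classical
  obtain ⟨P, hP⟩ := aux_left_inv A s (aux_krank_li A s hA)
  obtain ⟨Q, hQ⟩ := aux_left_inv B s (aux_krank_li B s hB)
  have e : P * (A * Matrix.diagonal d * Bᵀ) * Qᵀ =
      Matrix.diagonal (fun r : {x // x ∈ s} => d r.1) := by
    rw [aux_restrict A B s d hd]
    calc _ = (P * A.submatrix id (fun r : {x // x ∈ s} => r.1)) *
        Matrix.diagonal (fun r : {x // x ∈ s} => d r.1) *
        (Q * B.submatrix id (fun r : {x // x ∈ s} => r.1))ᵀ := by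
          rw [Matrix.transpose_mul]; simp only [Matrix.mul_assoc]
      _ = _ := by rw [hP, hQ]; simp
  have h1 : (Matrix.diagonal (fun r : {x // x ∈ s} => d r.1)).rank = s.card := by
    rw [Matrix.rank_of_isUnit, Fintype.card_coe]
    rw [Matrix.isUnit_iff_isUnit_det, Matrix.det_diagonal, isUnit_iff_ne_zero,
      Finset.prod_ne_zero_iff]
    exact fun r _ => hd' r.1 r.2
  rw [← h1, ← e]
  exact (Matrix.rank_mul_le_left _ _).trans (Matrix.rank_mul_le_right _ _)

theorem aux_rank_upper {I J R : ℕ} (A : Matrix (Fin I) (Fin R) F) (B : Matrix (Fin J) (Fin R) F)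
    (d : Fin R → F) (s : Finset (Fin R)) (hd : ∀ r, r ∉ s → d r = 0) :
    (A * Matrix.diagonal d * Bᵀ).rank ≤ s.card := by
  rw [aux_restrict A B s d hd]
  refine (Matrix.rank_mul_le_left _ _).trans ((Matrix.rank_mul_le_left _ _).trans ?_)
  simpa using Matrix.rank_le_card_width (A.submatrix id (fun r : {x // x ∈ s} => r.1))

set_option maxHeartbeats 1000000 in
open Classical in
/-- Counting step behind Kruskal's permutation lemma. -/
theorem aux_count {E : Type*} [AddCommGroup E] [Module F E] [FiniteDimensional F E] {R : ℕ}
    (c c' : Fin R → E) (n : ℕ)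
    (hn : R + 1 ≤ n + Module.finrank F (Submodule.span F (Set.range c')))
    (H : ∀ f : Module.Dual F E, (Finset.univ.filter (fun r => f (c' r) ≠ 0)).card ≤ n →
      (Finset.univ.filter (fun r => f (c r) ≠ 0)).card ≤
        (Finset.univ.filter (fun r => f (c' r) ≠ 0)).card)
    (hcV : ∀ r, c r ∈ Submodule.span F (Set.range c')) (k : ℕ) :
    ∀ S : Finset (Fin R), Module.finrank F (Submodule.span F (Set.image c' (S : Set (Fin R)))) + k + 1 =
      Module.finrank F (Submodule.span F (Set.range c')) →
      (Finset.univ.filter (fun r => c' r ∈ Submodule.span F (Set.image c' (S : Set (Fin R))))).card ≤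
      (Finset.univ.filter (fun r => c r ∈ Submodule.span F (Set.image c' (S : Set (Fin R))))).card := by
  set V := Submodule.span F (Set.range c') with hV
  have hc'V : ∀ r, c' r ∈ V := fun r => Submodule.subset_span ⟨r, rfl⟩
  induction k with
  | zero =>
    intro S hS
    set W := Submodule.span F (Set.image c' (S : Set (Fin R))) with hW
    have hWV : W ≤ V := Submodule.span_mono (Set.image_subset_range _ _)
    have hlt : ∃ v ∈ V, v ∉ W := by
      by_contra hcon
      push Not at hcon
      have := Submodule.finrank_mono (R := F) (show V ≤ W from hcon)
      omega
    obtain ⟨v, hvV, hvW⟩ := hlt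
    obtain ⟨f, hfv, hfW⟩ := Submodule.exists_dual_map_eq_bot_of_notMem hvW inferInstance
    have hWk : W ≤ LinearMap.ker f := by
      intro x hx
      have : f x ∈ W.map f := Submodule.mem_map_of_mem hx
      rw [hfW] at this
      exact (Submodule.mem_bot F).mp this
    have heq : W = V ⊓ LinearMap.ker f := by
      apply Submodule.eq_of_le_of_finrank_le (le_inf hWV hWk)
      have hl : V ⊓ LinearMap.ker f < V := by
        refine lt_of_le_of_ne inf_le_left fun h => hfv ?_
        have : v ∈ V ⊓ LinearMap.ker f := by rw [h]; exact hvV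
        exact this.2
      have := Submodule.finrank_lt_finrank_of_lt hl
      omega
    have hmem : ∀ x ∈ V, (x ∈ W ↔ ¬ f x ≠ 0) := by
      intro x hx
      rw [heq]
      simp [hx]
    have e1 : Finset.univ.filter (fun r => c r ∈ W) =
        Finset.univ.filter (fun r => ¬ f (c r) ≠ 0) :=
      Finset.filter_congr fun r _ => hmem _ (hcV r)
    have e2 : Finset.univ.filter (fun r => c' r ∈ W) =
        Finset.univ.filter (fun r => ¬ f (c' r) ≠ 0) :=
      Finset.filter_congr fun r _ => hmem _ (hc'V r)
    have s1 := Finset.card_filter_add_card_filter_not (s := (Finset.univ : Finset (Fin R)))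
      (fun r => f (c r) ≠ 0)
    have s2 := Finset.card_filter_add_card_filter_not (s := (Finset.univ : Finset (Fin R)))
      (fun r => f (c' r) ≠ 0)
    rw [← e1] at s1
    rw [← e2] at s2
    rw [Finset.card_univ, Fintype.card_fin] at s1 s2
    have hdim : Module.finrank F W ≤ (Finset.univ.filter (fun r => c' r ∈ W)).card := by
      have h1 : Module.finrank F W ≤ (S.image c').card := by
        have := finrank_span_finset_le_card (R := F) (S.image c')
        rw [Set.finrank, Finset.coe_image] at this
        exact this
      refine h1.trans (Finset.card_image_le.trans (Finset.card_le_card ?_))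
      intro r hr
      simp only [Finset.mem_filter, Finset.mem_univ, true_and]
      exact Submodule.subset_span ⟨r, hr, rfl⟩
    have := H f (by omega)
    omega
  | succ k ih =>
    intro S hS
    set W := Submodule.span F (Set.image c' (S : Set (Fin R))) with hW
    let U : Fin R → Submodule F E := fun r => W ⊔ Submodule.span F {c' r}
    let O : Finset (Fin R) := Finset.univ.filter (fun r => c' r ∉ W)
    have hU : ∀ r ∈ O, Module.finrank F (U r) = Module.finrank F W + 1 := by
      intro r hr
      exact Submodule.finrank_sup_span_singleton (by simpa [O] using hr)
    have hWU : ∀ r, W ≤ U r := fun r => le_sup_left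
    have hmU : ∀ r, c' r ∈ U r := fun r =>
      (le_sup_right : _ ≤ U r) (Submodule.mem_span_singleton_self _)
    have hUs : ∀ r, U r = Submodule.span F (Set.image c' ((insert r S : Finset (Fin R)) : Set (Fin R))) := by
      intro r
      simp only [U, hW]
      rw [Finset.coe_insert, Set.image_insert_eq, Submodule.span_insert, sup_comm]
    set 𝒰 := O.image U with h𝒰
    have hq : 2 ≤ 𝒰.card := by
      by_contra hlt
      have h1 : ∃ U0 : Submodule F E, Module.finrank F U0 ≤ Module.finrank F W + 1 ∧ ∀ r, c' r ∈ U0 := by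
        rcases Finset.eq_empty_or_nonempty O with hO | ⟨r, hr⟩
        · refine ⟨W, by omega, fun r => ?_⟩
          by_contra hcon
          have : r ∈ O := by simp [O, hcon]
          rw [hO] at this
          simp at this
        · refine ⟨U r, (hU r hr).le, fun r' => ?_⟩
          by_cases h' : c' r' ∈ W
          · exact hWU r h'
          · have hr' : r' ∈ O := by simp [O, h']
            have hc1 : 𝒰.card ≤ 1 := by omega
            have : U r = U r' := Finset.card_le_one.mp hc1 _
              (Finset.mem_image_of_mem U hr) _ (Finset.mem_image_of_mem U hr')
            rw [this]
            exact hmU r'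
      obtain ⟨U0, h2, h3⟩ := h1
      have : V ≤ U0 := Submodule.span_le.mpr (by rintro _ ⟨r, rfl⟩; exact h3 r)
      have := Submodule.finrank_mono (R := F) this
      omega
    have hb : ∀ X ∈ 𝒰, (Finset.univ.filter (fun r => c' r ∈ X)).card =
        (Finset.univ.filter (fun r => c' r ∈ W)).card + (O.filter (fun r => U r = X)).card := by
      intro X hX
      obtain ⟨r, hr, rfl⟩ := Finset.mem_image.mp hX
      rw [← Finset.card_union_of_disjoint]
      · congr 1
        ext s
        simp only [Finset.mem_filter, Finset.mem_univ, true_and, Finset.mem_union]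
        constructor
        · intro hs
          by_cases hsW : c' s ∈ W
          · exact Or.inl hsW
          · right
            have hsO : s ∈ O := by simp [O, hsW]
            refine ⟨hsO, ?_⟩
            apply Submodule.eq_of_le_of_finrank_le
            · exact sup_le (hWU r) (by simpa using hs)
            · rw [hU r hr, hU s hsO]
        · rintro (hs | ⟨-, hs⟩)
          · exact hWU r hs
          · rw [← hs]; exact hmU s
      · rw [Finset.disjoint_left]
        intro s hs hs'
        simp [O] at hs hs'
        exact hs'.1 hs
    have ha : ∀ X ∈ 𝒰, (Finset.univ.filter (fun r => c r ∈ X)).card =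
        (Finset.univ.filter (fun r => c r ∈ W)).card +
        (Finset.univ.filter (fun r => c r ∈ X ∧ c r ∉ W)).card := by
      intro X hX
      obtain ⟨r, hr, rfl⟩ := Finset.mem_image.mp hX
      rw [← Finset.card_union_of_disjoint]
      · congr 1
        ext s
        simp only [Finset.mem_filter, Finset.mem_univ, true_and, Finset.mem_union]
        constructor
        · intro h
          by_cases hw : c s ∈ W
          · exact Or.inl hw
          · exact Or.inr ⟨h, hw⟩
        · rintro (h | h)
          · exact hWU r h
          · exact h.1
      · rw [Finset.disjoint_left]
        intro s hs hs'
        simp at hs hs'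
        exact hs'.2 hs
    have hle : ∀ X ∈ 𝒰, (Finset.univ.filter (fun r => c' r ∈ X)).card ≤
        (Finset.univ.filter (fun r => c r ∈ X)).card := by
      intro X hX
      obtain ⟨r, hr, rfl⟩ := Finset.mem_image.mp hX
      have h1 := ih (insert r S)
      rw [← hUs r, hU r hr] at h1
      exact h1 (by omega)
    have hbs : (Finset.univ.filter (fun r => c' r ∈ W)).card +
        ∑ X ∈ 𝒰, (O.filter (fun r => U r = X)).card = R := by
      rw [h𝒰, ← Finset.card_eq_sum_card_image]
      have := Finset.card_filter_add_card_filter_not (s := (Finset.univ : Finset (Fin R)))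
        (fun r => c' r ∈ W)
      simpa [O] using this
    have has : (Finset.univ.filter (fun r => c r ∈ W)).card +
        ∑ X ∈ 𝒰, (Finset.univ.filter (fun r => c r ∈ X ∧ c r ∉ W)).card ≤ R := by
      rw [← Finset.card_biUnion]
      · have h1 := Finset.card_filter_add_card_filter_not (s := (Finset.univ : Finset (Fin R)))
          (fun r => c r ∈ W)
        rw [Finset.card_univ, Fintype.card_fin] at h1
        have h2 : (𝒰.biUnion fun X => Finset.univ.filter (fun r => c r ∈ X ∧ c r ∉ W)).card ≤
            (Finset.univ.filter (fun r => ¬ c r ∈ W)).card := by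
          apply Finset.card_le_card
          intro s hs
          simp only [Finset.mem_biUnion, Finset.mem_filter, Finset.mem_univ, true_and] at hs ⊢
          obtain ⟨_, _, _, h⟩ := hs
          exact h
        omega
      · intro X hX Y hY hXY
        obtain ⟨r, hr, rfl⟩ := Finset.mem_image.mp hX
        obtain ⟨r', hr', rfl⟩ := Finset.mem_image.mp hY
        refine Finset.disjoint_left.mpr ?_
        intro s hs hs'
        simp only [Finset.mem_filter, Finset.mem_univ, true_and] at hs hs'
        apply hXY
        have hl : W < U r ⊓ U r' := by
          refine lt_of_le_of_ne (le_inf (hWU r) (hWU r')) fun h => hs.2 ?_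
          rw [h]
          exact ⟨hs.1, hs'.1⟩
        have h3 := Submodule.finrank_lt_finrank_of_lt hl
        have h4 : U r ⊓ U r' = U r :=
          Submodule.eq_of_le_of_finrank_le inf_le_left (by rw [hU r hr]; omega)
        have h5 : U r ⊓ U r' = U r' :=
          Submodule.eq_of_le_of_finrank_le inf_le_right (by rw [hU r' hr']; omega)
        exact h4.symm.trans h5
    have hsum := Finset.sum_le_sum hle
    rw [Finset.sum_congr rfl hb, Finset.sum_congr rfl ha, Finset.sum_add_distrib,
      Finset.sum_add_distrib, Finset.sum_const, Finset.sum_const, smul_eq_mul, smul_eq_mul] at hsum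
    by_contra hcon
    push Not at hcon
    nlinarith

open Classical in
/-- Kruskal's permutation lemma. -/
theorem aux_perm {E : Type*} [AddCommGroup E] [Module F E] [FiniteDimensional F E] {R : ℕ}
    (c c' : Fin R → E) (h0 : ∀ r, c r ≠ 0)
    (hpair : ∀ r s, c s ∈ Submodule.span F {c r} → r = s)
    (h2 : 2 ≤ Module.finrank F (Submodule.span F (Set.range c)))
    (H : ∀ f : Module.Dual F E, (Finset.univ.filter (fun r => f (c' r) ≠ 0)).card ≤
        R - Module.finrank F (Submodule.span F (Set.range c)) + 1 →
      (Finset.univ.filter (fun r => f (c r) ≠ 0)).card ≤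
        (Finset.univ.filter (fun r => f (c' r) ≠ 0)).card) :
    ∃ σ : Equiv.Perm (Fin R), ∃ l : Fin R → F, (∀ r, l r ≠ 0) ∧ ∀ r, c' r = l r • c (σ r) := by
  have hcV : ∀ r, c r ∈ Submodule.span F (Set.range c') := by
    intro r
    by_contra hr
    obtain ⟨f, hfr, hfW⟩ := Submodule.exists_dual_map_eq_bot_of_notMem hr inferInstance
    have hz : ∀ s, f (c' s) = 0 := by
      intro s
      have : f (c' s) ∈ (Submodule.span F (Set.range c')).map f :=
        Submodule.mem_map_of_mem (Submodule.subset_span ⟨s, rfl⟩)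
      rw [hfW] at this
      exact (Submodule.mem_bot F).mp this
    have h3 := H f (by simp [hz])
    simp [hz] at h3
    exact hfr (@h3 r)
  have hdim := Submodule.finrank_mono (R := F)
    (show Submodule.span F (Set.range c) ≤ Submodule.span F (Set.range c') from
      Submodule.span_le.mpr (by rintro _ ⟨r, rfl⟩; exact hcV r))
  have hcnt := aux_count c c' _ (by omega) H hcV
  have hne : ∀ r, c' r ≠ 0 := by
    intro r hr
    have h3 := hcnt (Module.finrank F (Submodule.span F (Set.range c')) - 1) ∅ (by
      rw [Finset.coe_empty, Set.image_empty, Submodule.span_empty, finrank_bot]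
      omega)
    simp [h0, Finset.filter_eq_empty_iff] at h3
    exact h3 hr
  have hline : ∀ r, (Finset.univ.filter (fun s => c' s ∈ Submodule.span F {c' r})).card ≤
      (Finset.univ.filter (fun s => c s ∈ Submodule.span F {c' r})).card := by
    intro r
    have h3 := hcnt (Module.finrank F (Submodule.span F (Set.range c')) - 2) {r} (by
      rw [Finset.coe_singleton, Set.image_singleton]
      rw [finrank_span_singleton (hne r)]
      omega)
    simpa only [Finset.coe_singleton, Set.image_singleton] using h3
  have hsw : ∀ x y : E, x ≠ 0 → x ∈ Submodule.span F {y} → y ∈ Submodule.span F {x} := by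
    intro x y hx hxy
    obtain ⟨a, rfl⟩ := Submodule.mem_span_singleton.mp hxy
    have ha : a ≠ 0 := by rintro rfl; simp at hx
    exact Submodule.mem_span_singleton.mpr ⟨a⁻¹, by rw [smul_smul, inv_mul_cancel₀ ha, one_smul]⟩
  have htr : ∀ x y z : E, x ∈ Submodule.span F {y} → y ∈ Submodule.span F {z} →
      x ∈ Submodule.span F {z} := by
    intro x y z hxy hyz
    exact (Submodule.span_singleton_le_iff_mem _ _).mpr hyz hxy
  have hle1 : ∀ r, (Finset.univ.filter (fun s => c s ∈ Submodule.span F {c' r})).card ≤ 1 := by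
    intro r
    rw [Finset.card_le_one]
    intro s hs t ht
    simp only [Finset.mem_filter, Finset.mem_univ, true_and] at hs ht
    exact hpair s t (htr _ _ _ ht (hsw _ _ (h0 s) hs))
  have hex : ∀ r, ∃ s, c s ∈ Submodule.span F {c' r} := by
    intro r
    have h1 : 0 < (Finset.univ.filter (fun s => c' s ∈ Submodule.span F {c' r})).card :=
      Finset.card_pos.mpr ⟨r, by simp [Submodule.mem_span_singleton_self]⟩
    obtain ⟨s, hs⟩ := Finset.card_pos.mp (lt_of_lt_of_le h1 (hline r))
    exact ⟨s, by simpa using hs⟩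
  choose σ hσ using hex
  have hinj : Function.Injective σ := by
    intro r r' hrr
    have h1 : c' r' ∈ Submodule.span F {c' r} := by
      have := hsw _ _ (h0 _) (hσ r')
      rw [← hrr] at this
      exact htr _ _ _ this (hσ r)
    exact Finset.card_le_one.mp ((hline r).trans (hle1 r)) r
      (by simp [Submodule.mem_span_singleton_self]) r' (by simpa using h1)
  have hl : ∀ r, ∃ l : F, l • c (σ r) = c' r := fun r =>
    Submodule.mem_span_singleton.mp (hsw _ _ (h0 _) (hσ r))
  choose l hl using hl
  refine ⟨Equiv.ofBijective σ (Finite.injective_iff_bijective.mp hinj), l, ?_, fun r => (hl r).symm⟩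
  intro r hr
  have := hl r
  rw [hr, zero_smul] at this
  exact hne r this.symm

theorem aux_slice {I J K R : ℕ} {A A' : Matrix (Fin I) (Fin R) F} {B B' : Matrix (Fin J) (Fin R) F}
    {C C' : Matrix (Fin K) (Fin R) F} (h : pdTensor A B C = pdTensor A' B' C') (x : Fin K → F) :
    A * Matrix.diagonal (fun r => ∑ k, C k r * x k) * Bᵀ =
    A' * Matrix.diagonal (fun r => ∑ k, C' k r * x k) * B'ᵀ := by
  have key : ∀ (A : Matrix (Fin I) (Fin R) F) (B : Matrix (Fin J) (Fin R) F)
      (C : Matrix (Fin K) (Fin R) F) i j,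
      (A * Matrix.diagonal (fun r => ∑ k, C k r * x k) * Bᵀ) i j =
      ∑ k, pdTensor A B C i j k * x k := by
    intro A B C i j
    rw [Matrix.mul_apply]
    simp only [Matrix.mul_diagonal, Matrix.transpose_apply, pdTensor, Finset.sum_mul,
      Finset.mul_sum]
    rw [Finset.sum_comm]
    refine Finset.sum_congr rfl fun k _ => Finset.sum_congr rfl fun r _ => ?_
    ring
  ext i j
  rw [key, key, h]

/-- Uniqueness of the third factor. -/
theorem aux_third {I J K R : ℕ} {A A' : Matrix (Fin I) (Fin R) F}
    {B B' : Matrix (Fin J) (Fin R) F} {C C' : Matrix (Fin K) (Fin R) F}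
    (h : pdTensor A B C = pdTensor A' B' C') (hC : 2 ≤ krank C)
    (hA : R - C.rank + 1 ≤ krank A) (hB : R - C.rank + 1 ≤ krank B)
    (h2 : FullColRank (khatriRao (compound (R - C.rank + 2) A) (compound (R - C.rank + 2) B))) :
    ∃ σ : Equiv.Perm (Fin R), ∃ l : Fin R → F, (∀ r, l r ≠ 0) ∧
      ∀ k r, C' k r = l r * C k (σ r) := by
  classical
  have hrank : Module.finrank F (Submodule.span F (Set.range Cᵀ)) = C.rank :=
    (Matrix.rank_eq_finrank_span_cols C).symm
  have hkr := aux_krank_le_rank C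
  have hp := aux_perm (F := F) (E := Fin K → F) Cᵀ C'ᵀ ?_ ?_ ?_ ?_
  · obtain ⟨σ, l, hl, hcl⟩ := hp
    exact ⟨σ, l, hl, fun k r => congrFun (hcl r) k⟩
  · intro r
    have := aux_krank_li C {r} (by simp; omega)
    exact this.ne_zero ⟨r, by simp⟩
  · intro r s hs
    by_contra hne
    have hli := aux_krank_li C {r, s} (by rw [Finset.card_pair hne]; exact hC)
    obtain ⟨a, ha⟩ := Submodule.mem_span_singleton.mp hs
    have hg := Fintype.linearIndependent_iff.mp hli (fun t => if t.1 = r then a else -1) (by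
      rw [Finset.sum_coe_sort {r, s} (fun t => (if t = r then a else -1) • Cᵀ t),
        Finset.sum_pair hne, if_pos rfl, if_neg (Ne.symm hne), ha]
      simp) ⟨s, by simp⟩
    simp [Ne.symm hne] at hg
  · rw [hrank]; omega
  · intro f hf
    rw [hrank] at hf
    let x : Fin K → F := fun k => f (Pi.single k 1)
    have hfx : ∀ (M : Matrix (Fin K) (Fin R) F) r, f (Mᵀ r) = ∑ k, M k r * x k := by
      intro M r
      have h1 : Mᵀ r = ∑ k, M k r • (Pi.single k 1 : Fin K → F) := by
        funext k
        simp [Finset.sum_apply, Pi.single_apply]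
      rw [h1, map_sum]
      simp [x]
    have hs := aux_slice h x
    have hup := aux_rank_upper A' B' (fun r => ∑ k, C' k r * x k)
      (Finset.univ.filter (fun r => f (C'ᵀ r) ≠ 0)) (by
        intro r hr
        rw [← hfx]
        simpa using hr)
    rw [← hs] at hup
    set S := Finset.univ.filter (fun r => f (Cᵀ r) ≠ 0) with hS
    have hcard : S.card ≤ R - C.rank + 1 := by
      by_contra hlt
      obtain ⟨t, htS, htc⟩ := Finset.exists_subset_card_eq (s := S) (n := R - C.rank + 2) (by omega)
      have hz := aux_weight A B h2 (fun r => ∑ k, C k r * x k) (by omega) t htc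
      obtain ⟨r, hr, hr0⟩ := Finset.prod_eq_zero_iff.mp hz
      have := htS hr
      rw [hS, Finset.mem_filter] at this
      rw [← hfx] at hr0
      exact this.2 hr0
    have hlow := aux_rank_lower A B S (fun r => ∑ k, C k r * x k) (by
        intro r hr
        rw [← hfx]
        simpa [S] using hr) (by
        intro r hr
        rw [← hfx]
        simpa [S] using hr) (by omega) (by omega)
    exact hlow.trans hup

theorem aux_vec {K R : ℕ} (C : Matrix (Fin K) (Fin R) F) (Z : Finset (Fin R)) (r : Fin R)
    (hr : r ∉ Z) (hZ : Z.card + 1 ≤ krank C) :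
    ∃ x : Fin K → F, (∑ k, C k r * x k) ≠ 0 ∧ ∀ z ∈ Z, (∑ k, C k z * x k) = 0 := by
  classical
  obtain ⟨P, hP⟩ := aux_left_inv C (insert r Z) (aux_krank_li C _ (by
    rw [Finset.card_insert_of_notMem hr]; exact hZ))
  have key : ∀ s (hs : s ∈ insert r Z), ∑ k, C k s * P ⟨r, Finset.mem_insert_self r Z⟩ k =
      if r = s then 1 else 0 := by
    intro s hs
    have := congrFun (congrFun hP ⟨r, Finset.mem_insert_self r Z⟩) ⟨s, hs⟩
    rw [Matrix.mul_apply, Matrix.one_apply] at this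
    simp only [Matrix.submatrix_apply, id, Subtype.mk.injEq] at this
    rw [← this]
    exact Finset.sum_congr rfl fun k _ => mul_comm _ _
  refine ⟨P ⟨r, Finset.mem_insert_self r Z⟩, ?_, ?_⟩
  · rw [key r (Finset.mem_insert_self r Z)]
    simp
  · intro z hz
    rw [key z (Finset.mem_insert_of_mem hz), if_neg]
    rintro rfl
    exact hr hz

theorem aux_support {I J R : ℕ} {A A' : Matrix (Fin I) (Fin R) F}
    {B B' : Matrix (Fin J) (Fin R) F} (S : Finset (Fin R)) (d : Fin R → F)
    (hd : ∀ r, r ∉ S → d r = 0) (hd' : ∀ r ∈ S, d r ≠ 0)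
    (hA : S.card ≤ krank A) (hB : S.card ≤ krank B)
    (h : A * Matrix.diagonal d * Bᵀ = A' * Matrix.diagonal d * B'ᵀ) :
    (∀ r ∈ S, ∃ w : Fin R → F, (∀ s, s ∉ S → w s = 0) ∧ ∀ i, A' i r = ∑ s, A i s * w s) ∧
    (∀ l : Fin R → F, (∀ i r, A' i r = l r * A i r) → ∀ r ∈ S, ∀ j, l r * B' j r = B j r) := by
  classical
  obtain ⟨P, hP⟩ := aux_left_inv A S (aux_krank_li A S hA)
  obtain ⟨Q, hQ⟩ := aux_left_inv B S (aux_krank_li B S hB)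
  rw [aux_restrict A B S d hd, aux_restrict A' B' S d hd] at h
  set AS := A.submatrix id (fun r : {x // x ∈ S} => r.1) with hAS
  set BS := B.submatrix id (fun r : {x // x ∈ S} => r.1) with hBS
  set AS' := A'.submatrix id (fun r : {x // x ∈ S} => r.1) with hAS'
  set BS' := B'.submatrix id (fun r : {x // x ∈ S} => r.1) with hBS'
  set D := Matrix.diagonal (fun r : {x // x ∈ S} => d r.1) with hD
  set Di := Matrix.diagonal (fun r : {x // x ∈ S} => (d r.1)⁻¹) with hDi
  have hDD : Di * D = 1 := by
    rw [hD, hDi, Matrix.diagonal_mul_diagonal, ← Matrix.diagonal_one]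
    congr 1
    funext r
    exact inv_mul_cancel₀ (hd' r.1 r.2)
  have hDD' : D * Di = 1 := mul_eq_one_comm.mp hDD
  have hQ' : BSᵀ * Qᵀ = 1 := by rw [← Matrix.transpose_mul, hQ, Matrix.transpose_one]
  have h1 : AS * D = AS' * (D * BS'ᵀ * Qᵀ) := by
    calc AS * D = AS * D * BSᵀ * Qᵀ := by rw [Matrix.mul_assoc _ BSᵀ, hQ', Matrix.mul_one]
      _ = _ := by rw [h]; simp only [Matrix.mul_assoc]
  set M := D * BS'ᵀ * Qᵀ with hM
  have h2 : (Di * (P * AS')) * M = 1 := by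
    calc (Di * (P * AS')) * M = Di * (P * (AS' * M)) := by simp only [Matrix.mul_assoc]
      _ = Di * ((P * AS) * D) := by rw [← h1]; simp only [Matrix.mul_assoc]
      _ = 1 := by rw [hP, Matrix.one_mul, hDD]
  have h3 : M * (Di * (P * AS')) = 1 := mul_eq_one_comm.mp h2
  have h4 : AS' = AS * (P * AS') := by
    calc AS' = AS' * (M * (Di * (P * AS'))) := by rw [h3, Matrix.mul_one]
      _ = (AS * D) * (Di * (P * AS')) := by rw [h1]; simp only [Matrix.mul_assoc]
      _ = AS * ((D * Di) * (P * AS')) := by simp only [Matrix.mul_assoc]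
      _ = _ := by rw [hDD', Matrix.one_mul]
  constructor
  · intro r hr
    refine ⟨fun s => if hs : s ∈ S then (P * AS') ⟨s, hs⟩ ⟨r, hr⟩ else 0,
      fun s hs => by simp [hs], fun i => ?_⟩
    have h5 := congrFun (congrFun h4 i) ⟨r, hr⟩
    rw [Matrix.mul_apply] at h5
    have h6 : AS' i ⟨r, hr⟩ = A' i r := rfl
    rw [h6] at h5
    rw [h5, ← Finset.sum_subset (Finset.subset_univ S)]
    · rw [← Finset.sum_coe_sort S]
      refine Finset.sum_congr rfl fun s _ => ?_
      simp [hAS]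
    · intro s _ hs
      simp [hs]
  · intro l hl r hr j
    have h5 : AS' = AS * Matrix.diagonal (fun r : {x // x ∈ S} => l r.1) := by
      ext i s
      simp only [hAS, hAS', Matrix.mul_diagonal, Matrix.submatrix_apply, id]
      rw [hl, mul_comm]
    have h6 : D * BSᵀ = Matrix.diagonal (fun r : {x // x ∈ S} => l r.1) * D * BS'ᵀ := by
      calc D * BSᵀ = (P * AS) * D * BSᵀ := by rw [hP, Matrix.one_mul]
        _ = P * (AS * D * BSᵀ) := by simp only [Matrix.mul_assoc]
        _ = (P * AS) * Matrix.diagonal (fun r : {x // x ∈ S} => l r.1) * D * BS'ᵀ := by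
            rw [h, h5]; simp only [Matrix.mul_assoc]
        _ = _ := by rw [hP, Matrix.one_mul]
    have h7 := congrFun (congrFun h6 ⟨r, hr⟩) j
    rw [Matrix.mul_assoc] at h7
    simp only [hD, Matrix.diagonal_mul, Matrix.transpose_apply, hBS, hBS', Matrix.submatrix_apply,
      id] at h7
    have h8 := hd' r hr
    apply mul_left_cancel₀ h8
    rw [h7]
    ring

/-- With a common third factor the other two factors agree up to scaling. -/
theorem aux_second {I J K R : ℕ} {A A' : Matrix (Fin I) (Fin R) F}
    {B B' : Matrix (Fin J) (Fin R) F} {C : Matrix (Fin K) (Fin R) F}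
    (h : pdTensor A B C = pdTensor A' B' C) (hC : 2 ≤ krank C)
    (hA : R + 2 ≤ krank A + krank C) (hB : R + 1 ≤ krank B + krank C)
    (hb : ∀ r, Bᵀ r ≠ 0) :
    ∃ l : Fin R → F, (∀ r, l r ≠ 0) ∧ (∀ i r, A' i r = l r * A i r) ∧
      (∀ j r, B' j r = (l r)⁻¹ * B j r) := by
  classical
  have hCR := (aux_krank_mem C).1
  -- the window `G` around a given index
  have hG : ∀ r : Fin R, ∃ G : Finset (Fin R), r ∈ G ∧ G.card = R + 2 - krank C := by
    intro r
    obtain ⟨G, hG, -, hc⟩ := Finset.exists_subsuperset_card_eq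
      (Finset.subset_univ ({r} : Finset (Fin R))) (n := R + 2 - krank C)
      (by simp; omega) (by simp; omega)
    exact ⟨G, hG (by simp), hc⟩
  have hsup : ∀ (r : Fin R) (G : Finset (Fin R)), r ∈ G → G.card = R + 2 - krank C →
      ∀ j ∈ G, j ≠ r → ∃ S : Finset (Fin R), r ∈ S ∧ S ⊆ G.erase j ∧
      (∀ r ∈ S, ∃ w : Fin R → F, (∀ s, s ∉ S → w s = 0) ∧ ∀ i, A' i r = ∑ s, A i s * w s) ∧
      (∀ l : Fin R → F, (∀ i r, A' i r = l r * A i r) → ∀ r ∈ S, ∀ j, l r * B' j r = B j r) := by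
    intro r G hrG hGc j hj hjr
    have hec : (G.erase j).card = R + 1 - krank C := by
      rw [Finset.card_erase_of_mem hj, hGc]; omega
    obtain ⟨x, hx, hx0⟩ := aux_vec C (G.erase j)ᶜ r (by simp [hrG, Ne.symm hjr]) (by
      rw [Finset.card_compl, hec, Fintype.card_fin]; omega)
    set d : Fin R → F := fun r => ∑ k, C k r * x k with hd
    have hsub : Finset.univ.filter (fun r => d r ≠ 0) ⊆ G.erase j := by
      intro s hs
      by_contra hcon
      rw [Finset.mem_filter] at hs
      exact hs.2 (hx0 s (Finset.mem_compl.mpr hcon))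
    have hle := Finset.card_le_card hsub
    refine ⟨Finset.univ.filter (fun r => d r ≠ 0), by simpa using hx, hsub, ?_⟩
    exact aux_support _ d (fun s hs => by simpa using hs) (fun s hs => by simpa using hs)
      (by omega) (by omega) (aux_slice h x)
  have huniq : ∀ (G : Finset (Fin R)), G.card = R + 2 - krank C → ∀ w w' : Fin R → F,
      (∀ s, s ∉ G → w s = 0) → (∀ s, s ∉ G → w' s = 0) →
      (∀ i, ∑ s, A i s * w s = ∑ s, A i s * w' s) → w = w' := by
    intro G hGc w w' hw hw' he
    have hli := Fintype.linearIndependent_iff.mp (aux_krank_li A G (by omega))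
      (fun s => w s.1 - w' s.1) (by
        funext i
        rw [Finset.sum_apply]
        simp only [Pi.smul_apply, smul_eq_mul, Matrix.transpose_apply, Pi.zero_apply]
        rw [Finset.sum_coe_sort G (fun s => (w s - w' s) * A i s),
          Finset.sum_subset (Finset.subset_univ G)]
        · have := he i
          rw [← sub_eq_zero, ← Finset.sum_sub_distrib] at this
          rw [← this]
          exact Finset.sum_congr rfl fun s _ => by ring
        · intro s _ hs
          simp [hw s hs, hw' s hs])
    funext s
    by_cases hs : s ∈ G
    · exact sub_eq_zero.mp (hli ⟨s, hs⟩)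
    · rw [hw s hs, hw' s hs]
  have hj : ∀ (r : Fin R) (G : Finset (Fin R)), r ∈ G → G.card = R + 2 - krank C →
      ∃ j ∈ G, j ≠ r := by
    intro r G hr hGc
    exact Finset.exists_mem_ne (by omega) r
  have hscale : ∀ r, ∃ l : F, ∀ i, A' i r = l * A i r := by
    intro r
    obtain ⟨G, hrG, hGc⟩ := hG r
    obtain ⟨j0, hj0, hj0r⟩ := hj r G hrG hGc
    obtain ⟨S, hrS, hSG, hw, -⟩ := hsup r G hrG hGc j0 hj0 hj0r
    obtain ⟨w, hw0, hwA⟩ := hw r hrS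
    have hwG : ∀ s, s ∉ G → w s = 0 := fun s hs =>
      hw0 s fun hsS => hs (Finset.mem_of_mem_erase (hSG hsS))
    have hz : ∀ j, j ≠ r → w j = 0 := by
      intro j hjr
      by_cases hjG : j ∈ G
      · obtain ⟨S', hrS', hSG', hw', -⟩ := hsup r G hrG hGc j hjG hjr
        obtain ⟨w', hw0', hwA'⟩ := hw' r hrS'
        have hwG' : ∀ s, s ∉ G → w' s = 0 := fun s hs =>
          hw0' s fun hsS => hs (Finset.mem_of_mem_erase (hSG' hsS))
        rw [huniq G hGc w w' hwG hwG' (fun i => by rw [← hwA, ← hwA'])]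
        exact hw0' j fun hjS => Finset.notMem_erase j G (hSG' hjS)
      · exact hwG j hjG
    refine ⟨w r, fun i => ?_⟩
    rw [hwA i, Finset.sum_eq_single r]
    · ring
    · intro s _ hs
      simp [hz s hs]
    · simp
  choose l hl using hscale
  have hlB : ∀ j r, l r * B' j r = B j r := by
    intro j r
    obtain ⟨G, hrG, hGc⟩ := hG r
    obtain ⟨j0, hj0, hj0r⟩ := hj r G hrG hGc
    obtain ⟨S, hrS, -, -, hS⟩ := hsup r G hrG hGc j0 hj0 hj0r
    exact hS l (fun i r => hl r i) r hrS j
  have hl0 : ∀ r, l r ≠ 0 := by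
    intro r hr
    apply hb r
    funext j
    have := hlB j r
    rw [hr, zero_mul] at this
    exact this.symm
  refine ⟨l, hl0, fun i r => hl r i, fun j r => ?_⟩
  rw [← hlB j r, inv_mul_cancel_left₀ (hl0 r)]

theorem aux_core {I J K R : ℕ} {A A' : Matrix (Fin I) (Fin R) F}
    {B B' : Matrix (Fin J) (Fin R) F} {C C' : Matrix (Fin K) (Fin R) F}
    (h : pdTensor A B C = pdTensor A' B' C')
    (ha : ∀ r, Aᵀ r ≠ 0) (hb : ∀ r, Bᵀ r ≠ 0)
    (h1 : max (min (krank A) (krank B - 1)) (min (krank A - 1) (krank B)) + krank C ≥ R + 1)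
    (h2 : FullColRank (khatriRao (compound (R - C.rank + 2) A) (compound (R - C.rank + 2) B))) :
    ∃ σ : Equiv.Perm (Fin R), ∃ la lb lc : Fin R → F,
      (∀ r, la r * lb r * lc r = 1) ∧
      (∀ i r, A' i r = A i (σ r) * la r) ∧
      (∀ j r, B' j r = B j (σ r) * lb r) ∧
      (∀ k r, C' k r = C k (σ r) * lc r) := by
  have hAR := (aux_krank_mem A).1
  have hBR := (aux_krank_mem B).1
  have hCR := (aux_krank_mem C).1
  have hCr := aux_krank_le_rank C
  have hCw : C.rank ≤ R := by simpa using Matrix.rank_le_card_width C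
  have hC2 : 2 ≤ krank C := by omega
  obtain ⟨σ, l, hl, hlC⟩ := aux_third h hC2 (by omega) (by omega) h2
  let A2 : Matrix (Fin I) (Fin R) F := fun i s => l (σ.symm s) * A' i (σ.symm s)
  let B2 : Matrix (Fin J) (Fin R) F := fun j s => B' j (σ.symm s)
  have hT : pdTensor A B C = pdTensor A2 B2 C := by
    rw [h]
    funext i j k
    refine Fintype.sum_equiv σ _ _ fun r => ?_
    simp only [A2, B2, Equiv.symm_apply_apply, hlC]
    ring
  have hfin : ∃ α β : Fin R → F, (∀ r, α r * β r = 1) ∧ (∀ i r, A2 i r = α r * A i r) ∧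
      (∀ j r, B2 j r = β r * B j r) := by
    by_cases hcase : R + 2 ≤ krank A + krank C
    · obtain ⟨α, h0, hα, hβ⟩ := aux_second hT hC2 hcase (by omega) hb
      exact ⟨α, fun r => (α r)⁻¹, fun r => mul_inv_cancel₀ (h0 r), hα, hβ⟩
    · have hT' : pdTensor B A C = pdTensor B2 A2 C := by
        funext j i k
        have := congrFun (congrFun (congrFun hT i) j) k
        simp only [pdTensor] at this ⊢
        calc _ = ∑ r, A i r * B j r * C k r := Finset.sum_congr rfl fun r _ => by ring
          _ = ∑ r, A2 i r * B2 j r * C k r := this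
          _ = _ := Finset.sum_congr rfl fun r _ => by ring
      obtain ⟨β, h0, hβ, hα⟩ := aux_second hT' hC2 (by omega) (by omega) ha
      exact ⟨fun r => (β r)⁻¹, β, fun r => inv_mul_cancel₀ (h0 r), hα, hβ⟩
  obtain ⟨α, β, hαβ, hα, hβ⟩ := hfin
  refine ⟨σ, fun r => (l r)⁻¹ * α (σ r), fun r => β (σ r), l, ?_, ?_, ?_, ?_⟩
  · intro r
    calc _ = ((l r)⁻¹ * l r) * (α (σ r) * β (σ r)) := by ring
      _ = 1 := by rw [hαβ, inv_mul_cancel₀ (hl r), one_mul]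
  · intro i r
    have := hα i (σ r)
    simp only [A2, Equiv.symm_apply_apply] at this
    calc A' i r = (l r)⁻¹ * (l r * A' i r) := by rw [inv_mul_cancel_left₀ (hl r)]
      _ = _ := by rw [this]; ring
  · intro j r
    have := hβ j (σ r)
    simp only [B2, Equiv.symm_apply_apply] at this
    rw [this, mul_comm]
  · intro k r
    rw [hlC, mul_comm]

/-- Corollary 1.16: uniqueness of the CPD under (5.1) and (C m_C). -/
theorem stmt_5 {I J K R : ℕ} (T : Fin I → Fin J → Fin K → F)
    (A : Matrix (Fin I) (Fin R) F) (B : Matrix (Fin J) (Fin R) F) (C : Matrix (Fin K) (Fin R) F)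
    (hPD : IsPD T A B C)
    (h1 : max (min (krank A) (krank B - 1)) (min (krank A - 1) (krank B)) + krank C ≥ R + 1)
    (h2 : FullColRank (khatriRao (compound (R - C.rank + 2) A) (compound (R - C.rank + 2) B))) :
    tensorRank T = R ∧ CPDUnique T R := by
  obtain ⟨ha, hb, hc, hT⟩ := hPD
  have hcore : ∀ (A' : Matrix (Fin I) (Fin R) F) (B' : Matrix (Fin J) (Fin R) F)
      (C' : Matrix (Fin K) (Fin R) F), T = pdTensor A' B' C' →
      ∃ σ : Equiv.Perm (Fin R), ∃ la lb lc : Fin R → F,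
      (∀ r, la r * lb r * lc r = 1) ∧
      (∀ i r, A' i r = A i (σ r) * la r) ∧
      (∀ j r, B' j r = B j (σ r) * lb r) ∧
      (∀ k r, C' k r = C k (σ r) * lc r) := fun A' B' C' h =>
    aux_core (hT.symm.trans h) ha hb h1 h2
  constructor
  · apply le_antisymm
    · exact Nat.sInf_le ⟨A, B, C, ha, hb, hc, hT⟩
    · have hmem : tensorRank T ∈ {R | ∃ A : Matrix (Fin I) (Fin R) F,
          ∃ B : Matrix (Fin J) (Fin R) F, ∃ C : Matrix (Fin K) (Fin R) F, IsPD T A B C} :=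
        Nat.sInf_mem ⟨R, A, B, C, ha, hb, hc, hT⟩
      by_contra hlt
      generalize tensorRank T = R' at hmem hlt
      obtain ⟨A', B', C', -, -, -, hT'⟩ := hmem
      clear h1 h2
      obtain ⟨n, hn⟩ := Nat.exists_eq_add_of_lt (not_le.mp hlt)
      rw [Nat.add_assoc] at hn
      subst hn
      obtain ⟨σ, la, lb, lc, hl, hA, -, -⟩ := hcore
        (fun i => Fin.append (A' i) (fun _ : Fin (n + 1) => 0))
        (fun i => Fin.append (B' i) (fun _ : Fin (n + 1) => 0))
        (fun i => Fin.append (C' i) (fun _ : Fin (n + 1) => 0)) (by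
          rw [hT']
          funext i j k
          simp only [pdTensor]
          symm
          refine (Fin.sum_univ_add (a := R') (b := n + 1) _).trans ?_
          simp)
      have hla : la (Fin.natAdd R' (0 : Fin (n + 1))) ≠ 0 := by
        intro h0
        have := hl (Fin.natAdd R' (0 : Fin (n + 1)))
        rw [h0] at this
        simp at this
      apply ha (σ (Fin.natAdd R' (0 : Fin (n + 1))))
      funext i
      have := hA i (Fin.natAdd R' (0 : Fin (n + 1)))
      rw [Fin.append_right] at this
      rcases mul_eq_zero.mp this.symm with h | h
      · exact h
      · exact absurd h hla
  · intro A1 A2 B1 B2 C1 C2 hP1 hP2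
    obtain ⟨σ1, la1, lb1, lc1, hl1, hA1, hB1, hC1⟩ := hcore A1 B1 C1 hP1.2.2.2
    obtain ⟨σ2, la2, lb2, lc2, hl2, hA2, hB2, hC2⟩ := hcore A2 B2 C2 hP2.2.2.2
    have hne : ∀ r, la1 r ≠ 0 ∧ lb1 r ≠ 0 ∧ lc1 r ≠ 0 := by
      intro r
      have := hl1 r
      refine ⟨?_, ?_, ?_⟩ <;> intro h0 <;> simp [h0] at this
    refine ⟨σ2.trans σ1.symm, fun r => la2 r * (la1 (σ1.symm (σ2 r)))⁻¹,
      fun r => lb2 r * (lb1 (σ1.symm (σ2 r)))⁻¹,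
      fun r => lc2 r * (lc1 (σ1.symm (σ2 r)))⁻¹, ?_, ?_, ?_, ?_⟩
    · intro r
      calc _ = (la2 r * lb2 r * lc2 r) * (la1 (σ1.symm (σ2 r)) * lb1 (σ1.symm (σ2 r)) *
            lc1 (σ1.symm (σ2 r)))⁻¹ := by rw [mul_inv, mul_inv]; ring
        _ = 1 := by rw [hl1, hl2]; simp
    · intro i r
      have h0 := (hne (σ1.symm (σ2 r))).1
      rw [hA1, hA2]
      simp only [Equiv.trans_apply, Equiv.apply_symm_apply]
      field_simp
    · intro i r
      have h0 := (hne (σ1.symm (σ2 r))).2.1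
      rw [hB1, hB2]
      simp only [Equiv.trans_apply, Equiv.apply_symm_apply]
      field_simp
    · intro i r
      have h0 := (hne (σ1.symm (σ2 r))).2.2
      rw [hC1, hC2]
      simp only [Equiv.trans_apply, Equiv.apply_symm_apply]
      field_simp
end

section
/- Let T = [A,B,C]_R with A ∈ F^{I×R}, B ∈ F^{J×R}, C ∈ F^{K×R}, and set m_A := R − r_A + 2, m_B := R − r_B + 2, m_C := R − r_C + 2. Assume that at least two of the following hold: (i) condition (H m_A) holds for the pair (B,C); (ii) condition (H m_B) holds for the pair (C,A); (iii) condition (H m_C) holds for the pair (A,B). Then r_T = R and the CPD of T is unique. -/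
open scoped Matrix
open MeasureTheory

variable {F : Type*} [RCLike F]

section KruskalHelpers

open Submodule Module

variable {𝕜 : Type*} [Field 𝕜]

/-- Span of the vectors `x a`, `a ∈ S`. -/
def cpdSp {ι α : Type*} (x : ι → α → 𝕜) (S : Finset ι) : Submodule 𝕜 (α → 𝕜) :=
  span 𝕜 (Set.image x (S : Set ι))

/-- Dimension of the span of the vectors `x a`, `a ∈ S`. -/
noncomputable def cpdDm {ι α : Type*} (x : ι → α → 𝕜) (S : Finset ι) : ℕ :=
  finrank 𝕜 (cpdSp x S)

/-- Pointwise tensor product of families. -/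
def cpdPr {ι α β : Type*} (x : ι → α → 𝕜) (y : ι → β → 𝕜) : ι → α × β → 𝕜 :=
  fun a p => x a p.1 * y a p.2

/-- Connectivity of `E` relative to the base `S`. -/
def cpdConn {ι α : Type*} [DecidableEq ι] (z : ι → α → 𝕜) (S E : Finset ι) : Prop :=
  ∀ P Q : Finset ι, S ⊆ P → Q.Nonempty → Disjoint P Q → P ∪ Q = E →
    ¬ Disjoint (cpdSp z P) (cpdSp z Q)

theorem cpdSp_mono {ι α : Type*} (x : ι → α → 𝕜) {S T : Finset ι} (h : S ⊆ T) :
    cpdSp x S ≤ cpdSp x T :=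
  span_mono (Set.image_mono (by exact_mod_cast h))

theorem cpdDm_mono {ι α : Type*} [Finite α] (x : ι → α → 𝕜) {S T : Finset ι} (h : S ⊆ T) :
    cpdDm x S ≤ cpdDm x T :=
  Submodule.finrank_mono (cpdSp_mono x h)

theorem cpdSp_union {ι α : Type*} [DecidableEq ι] (x : ι → α → 𝕜) (S T : Finset ι) :
    cpdSp x (S ∪ T) = cpdSp x S ⊔ cpdSp x T := by
  simp [cpdSp, Set.image_union, span_union]

theorem cpdMem {ι α : Type*} (x : ι → α → 𝕜) {S : Finset ι} {a : ι} (h : a ∈ S) :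
    x a ∈ cpdSp x S := subset_span ⟨a, by exact_mod_cast h, rfl⟩

theorem cpdSp_eq_range {ι α : Type*} (x : ι → α → 𝕜) (S : Finset ι) :
    cpdSp x S = span 𝕜 (Set.range fun a : {a // a ∈ S} => x a.1) := by
  unfold cpdSp
  congr 1
  ext v
  simp

theorem cpdDm_le_card {ι α : Type*} (x : ι → α → 𝕜) (S : Finset ι) :
    cpdDm x S ≤ S.card := by
  unfold cpdDm
  rw [cpdSp_eq_range]
  exact (finrank_range_le_card (R := 𝕜) (fun a : {a // a ∈ S} => x a.1)).trans (by simp)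

theorem cpdDm_union_le {ι α : Type*} [Finite α] [DecidableEq ι] (x : ι → α → 𝕜)
    (S T : Finset ι) : cpdDm x (S ∪ T) ≤ cpdDm x S + cpdDm x T := by
  unfold cpdDm
  rw [cpdSp_union]
  have := finrank_sup_add_finrank_inf_eq (cpdSp x S) (cpdSp x T)
  omega

theorem cpd_slice_left {ι α β : Type*} (x : ι → α → 𝕜) (y : ι → β → 𝕜) {S : Finset ι}
    {w : α × β → 𝕜} (hw : w ∈ cpdSp (cpdPr x y) S) (j : β) :
    (fun i => w (i, j)) ∈ cpdSp x S := by
  unfold cpdSp at hw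
  induction hw using span_induction with
  | mem v hv =>
    obtain ⟨a, ha, rfl⟩ := hv
    have : (fun i => cpdPr x y a (i, j)) = y a j • x a := by
      ext i; simp [cpdPr, mul_comm]
    rw [this]
    exact smul_mem _ _ (cpdMem x (by exact_mod_cast ha))
  | zero => exact zero_mem _
  | add u v _ _ hu hv => exact add_mem hu hv
  | smul c v _ hv => exact smul_mem _ c hv

theorem cpd_slice_right {ι α β : Type*} (x : ι → α → 𝕜) (y : ι → β → 𝕜) {S : Finset ι}
    {w : α × β → 𝕜} (hw : w ∈ cpdSp (cpdPr x y) S) (i : α) :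
    (fun j => w (i, j)) ∈ cpdSp y S := by
  unfold cpdSp at hw
  induction hw using span_induction with
  | mem v hv =>
    obtain ⟨a, ha, rfl⟩ := hv
    have : (fun j => cpdPr x y a (i, j)) = x a i • y a := by
      ext j; simp [cpdPr]
    rw [this]
    exact smul_mem _ _ (cpdMem y (by exact_mod_cast ha))
  | zero => exact zero_mem _
  | add u v _ _ hu hv => exact add_mem hu hv
  | smul c v _ hv => exact smul_mem _ c hv

theorem cpdConn_left {ι α β : Type*} [DecidableEq ι] (x : ι → α → 𝕜) (y : ι → β → 𝕜)
    {S E : Finset ι} (h : cpdConn (cpdPr x y) S E) : cpdConn x S E := by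
  intro P Q hS hQ hPQ hE hd
  refine h P Q hS hQ hPQ hE ?_
  rw [Submodule.disjoint_def] at hd ⊢
  intro w h1 h2
  ext ⟨i, j⟩
  exact congrFun (hd _ (cpd_slice_left x y h1 j) (cpd_slice_left x y h2 j)) i

theorem cpdConn_mono {ι α : Type*} [DecidableEq ι] (z : ι → α → 𝕜)
    {S S' E : Finset ι} (hS : S ⊆ S') (h : cpdConn z S E) : cpdConn z S' E :=
  fun P Q hP => h P Q (hS.trans hP)

/-- Rank count for a relation lying in the base. -/
theorem cpd_count {ι α β : Type*} [Finite α] [Finite β] [DecidableEq ι]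
    (x : ι → α → 𝕜) (y : ι → β → 𝕜) (S D : Finset ι) (c : {a // a ∈ D} → 𝕜)
    (hc : ∀ a, c a ≠ 0)
    (hw : ∑ a, c a • cpdPr x y a.1 ∈ cpdSp (cpdPr x y) S) :
    cpdDm x (S ∪ D) + cpdDm y D ≤ cpdDm x S + D.card := by
  classical
  have := Fintype.ofFinite β
  set φ : ({a // a ∈ D} → 𝕜) →ₗ[𝕜] (α → 𝕜) :=
    Fintype.linearCombination 𝕜 (fun a : {a // a ∈ D} => x a.1) with hφ
  have hr : LinearMap.range φ = cpdSp x D := by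
    rw [hφ, Fintype.range_linearCombination, cpdSp_eq_range]
  set N : Submodule 𝕜 ({a // a ∈ D} → 𝕜) := (cpdSp x S).comap φ with hN
  have h1 : cpdDm y D ≤ finrank 𝕜 N := by
    let M : Matrix β {a // a ∈ D} 𝕜 := Matrix.of fun j a => c a * y a.1 j
    have e1 : cpdDm y D = M.rank := by
      rw [Matrix.rank_eq_finrank_span_cols]
      unfold cpdDm
      rw [cpdSp_eq_range]
      have hspan : span 𝕜 (Set.range fun a : {a // a ∈ D} => y a.1) =
          span 𝕜 (Set.range M.col) := by
        apply le_antisymm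
        · rw [span_le]
          rintro _ ⟨a, rfl⟩
          have : y a.1 = (c a)⁻¹ • M.col a := by
            ext j
            simp [M, Matrix.col, hc a]
          simp only [this]
          exact smul_mem _ _ (subset_span ⟨a, rfl⟩)
        · rw [span_le]
          rintro _ ⟨a, rfl⟩
          have : M.col a = c a • y a.1 := by
            ext j
            simp [M, Matrix.col]
          simp only [this]
          exact smul_mem _ _ (subset_span ⟨a, rfl⟩)
      rw [hspan]
    rw [e1, Matrix.rank_eq_finrank_span_row]
    apply Submodule.finrank_mono
    rw [span_le]
    rintro _ ⟨j, rfl⟩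
    have := cpd_slice_left x y hw j
    simp only [hN, SetLike.mem_coe, mem_comap]
    convert this using 1
    ext i
    simp [hφ, Fintype.linearCombination_apply, M, Matrix.row, cpdPr, Finset.sum_apply]
    refine Finset.sum_congr rfl fun a _ => by ring
  have h2 : finrank 𝕜 N ≤ finrank 𝕜 (cpdSp x S ⊓ cpdSp x D : Submodule 𝕜 (α → 𝕜))
      + finrank 𝕜 (LinearMap.ker φ) := by
    have := LinearMap.finrank_range_add_finrank_ker (φ.domRestrict N)
    have a1 : finrank 𝕜 (LinearMap.range (φ.domRestrict N)) ≤
        finrank 𝕜 (cpdSp x S ⊓ cpdSp x D : Submodule 𝕜 (α → 𝕜)) := by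
      apply Submodule.finrank_mono
      rintro _ ⟨v, rfl⟩
      refine ⟨v.2, ?_⟩
      rw [← hr]
      exact ⟨v.1, rfl⟩
    have a2 : finrank 𝕜 (LinearMap.ker (φ.domRestrict N)) ≤ finrank 𝕜 (LinearMap.ker φ) := by
      rw [LinearEquiv.finrank_eq (Submodule.equivMapOfInjective N.subtype N.injective_subtype
        (LinearMap.ker (φ.domRestrict N)))]
      apply Submodule.finrank_mono
      rintro _ ⟨v, hv, rfl⟩
      exact hv
    omega
  have h3 := LinearMap.finrank_range_add_finrank_ker φ
  rw [hr] at h3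
  have h4 := finrank_sup_add_finrank_inf_eq (cpdSp x S) (cpdSp x D)
  rw [← cpdSp_union] at h4
  have h5 : finrank 𝕜 ({a // a ∈ D} → 𝕜) = D.card := by simp
  unfold cpdDm at *
  omega

/-- Existence of a good ear. -/
theorem cpd_ear {ι α β : Type*} [Finite α] [Finite β] [DecidableEq ι]
    (x : ι → α → 𝕜) (y : ι → β → 𝕜) (S G : Finset ι)
    (h : ¬ Disjoint (cpdSp (cpdPr x y) S) (cpdSp (cpdPr x y) G)) :
    ∃ D ⊆ G, D.Nonempty ∧
      cpdDm x (S ∪ D) + cpdDm y (S ∪ D) + cpdDm (cpdPr x y) S ≤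
        cpdDm x S + cpdDm y S + cpdDm (cpdPr x y) (S ∪ D) := by
  classical
  set z := cpdPr x y with hz
  obtain ⟨D, hD, hmin⟩ := Finset.exists_min_image
    (G.powerset.filter fun D => ¬ Disjoint (cpdSp z S) (cpdSp z D)) Finset.card
    ⟨G, by simp [h]⟩
  simp only [Finset.mem_filter, Finset.mem_powerset] at hD hmin
  obtain ⟨hDG, hDd⟩ := hD
  have hlt : ∀ a ∈ D, Disjoint (cpdSp z S) (cpdSp z (D.erase a)) := by
    intro a ha
    by_contra hcon
    have := hmin (D.erase a) ⟨(Finset.erase_subset _ _).trans hDG, hcon⟩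
    have := Finset.card_erase_lt_of_mem ha
    omega
  have hne : D.Nonempty := by
    rw [Finset.nonempty_iff_ne_empty]
    rintro rfl
    apply hDd
    simp [cpdSp]
  refine ⟨D, hDG, hne, ?_⟩
  -- linear independence
  have hli : LinearIndepOn 𝕜 z (D : Set ι) := by
    rw [linearIndepOn_iff_notMem_span]
    intro a ha hmem
    have ha' : a ∈ D := by exact_mod_cast ha
    apply hDd
    have : cpdSp z D ≤ cpdSp z (D.erase a) := by
      refine span_le.2 ?_
      rintro _ ⟨b, hb, rfl⟩
      by_cases hba : b = a
      · subst hba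
        simpa [cpdSp] using hmem
      · exact cpdMem z (Finset.mem_erase.2 ⟨hba, by exact_mod_cast hb⟩)
    exact (hlt a ha').mono_right this
  obtain ⟨a, ha⟩ := hne
  have hrank : cpdDm z S + D.card ≤ cpdDm z (S ∪ D) + 1 := by
    have h1 : cpdDm z (D.erase a) = (D.erase a).card := by
      unfold cpdDm
      rw [cpdSp_eq_range]
      have : LinearIndepOn 𝕜 z ((D.erase a : Finset ι) : Set ι) :=
        hli.mono (by simp)
      exact (finrank_span_eq_card this.linearIndependent).trans (Fintype.card_coe _)
    have h2 : cpdDm z (S ∪ D.erase a) = cpdDm z S + cpdDm z (D.erase a) := by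
      unfold cpdDm
      rw [cpdSp_union]
      have := finrank_sup_add_finrank_inf_eq (cpdSp z S) (cpdSp z (D.erase a))
      rw [(hlt a ha).eq_bot] at this
      simpa using this
    have h3 : cpdDm z (S ∪ D.erase a) ≤ cpdDm z (S ∪ D) :=
      cpdDm_mono z (Finset.union_subset_union_right (Finset.erase_subset _ _))
    have h4 := Finset.card_erase_add_one ha
    omega
  rw [Submodule.disjoint_def] at hDd
  push Not at hDd
  obtain ⟨w, hwS, hwD, hw0⟩ := hDd
  obtain ⟨c, hc⟩ := (mem_span_image_finset_iff_exists_fun 𝕜).1 hwD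
  have hc0 : ∀ b, c b ≠ 0 := by
    intro b hb
    apply hw0
    refine (Submodule.disjoint_def.1 (hlt b.1 b.2)) w hwS ?_
    rw [← hc]
    refine sum_mem fun d _ => ?_
    by_cases hdb : d = b
    · subst hdb; simp [hb]
    · exact smul_mem _ _ (cpdMem z (Finset.mem_erase.2 ⟨fun h => hdb (Subtype.ext h), d.2⟩))
  have hcount := cpd_count x y S D c hc0 (by rw [← hz, hc]; exact hwS)
  have hy : cpdDm y (S ∪ D) + 1 ≤ cpdDm y S + cpdDm y D := by
    have h1 := finrank_sup_add_finrank_inf_eq (cpdSp y S) (cpdSp y D)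
    rw [← cpdSp_union] at h1
    have h2 : 1 ≤ finrank 𝕜 (cpdSp y S ⊓ cpdSp y D : Submodule 𝕜 (β → 𝕜)) := by
      rw [Submodule.one_le_finrank_iff]
      intro hbot
      apply hw0
      ext ⟨i, j⟩
      have : (fun j => w (i, j)) ∈ cpdSp y S ⊓ cpdSp y D :=
        ⟨cpd_slice_right x y hwS i, cpd_slice_right x y hwD i⟩
      rw [hbot, mem_bot] at this
      exact congrFun this j
    unfold cpdDm
    omega
  omega

/-- The relative splitting theorem for two factors. -/
theorem cpd_two {ι α β : Type*} [Finite α] [Finite β] [DecidableEq ι]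
    (x : ι → α → 𝕜) (y : ι → β → 𝕜) (E : Finset ι) :
    ∀ (n : ℕ) (S : Finset ι), (E \ S).card = n → S ⊆ E → cpdConn (cpdPr x y) S E →
      cpdDm x E + cpdDm y E + cpdDm (cpdPr x y) S ≤
        cpdDm x S + cpdDm y S + cpdDm (cpdPr x y) E := by
  intro n
  induction n using Nat.strong_induction_on with
  | _ n ih =>
    intro S hn hSE hconn
    by_cases hE : (E \ S).Nonempty
    · obtain ⟨D, hDG, hDne, hD⟩ := cpd_ear x y S (E \ S)
        (hconn S (E \ S) subset_rfl hE Finset.disjoint_sdiff (Finset.union_sdiff_of_subset hSE))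
      have hsub : S ∪ D ⊆ E := Finset.union_subset hSE (hDG.trans Finset.sdiff_subset)
      have hlt : (E \ (S ∪ D)).card < n := by
        rw [← hn]
        apply Finset.card_lt_card
        obtain ⟨d, hd⟩ := hDne
        refine ⟨Finset.sdiff_subset_sdiff subset_rfl Finset.subset_union_left, fun hcon => ?_⟩
        have := hcon (hDG hd)
        simp [hd] at this
      have := ih _ hlt (S ∪ D) rfl hsub (cpdConn_mono _ Finset.subset_union_left hconn)
      omega
    · have : S = E := by
        rw [Finset.not_nonempty_iff_eq_empty, Finset.sdiff_eq_empty_iff_subset] at hE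
        exact subset_antisymm hSE hE
      subst this
      omega

/-- The splitting theorem for three factors. -/
theorem cpd_three {ι α β γ : Type*} [Finite α] [Finite β] [Finite γ] [DecidableEq ι]
    (x : ι → α → 𝕜) (y : ι → β → 𝕜) (v : ι → γ → 𝕜) (E : Finset ι) (a : ι) (ha : a ∈ E)
    (h0 : cpdPr (cpdPr x y) v a ≠ 0)
    (hconn : cpdConn (cpdPr (cpdPr x y) v) {a} E) :
    cpdDm x E + cpdDm y E + cpdDm v E ≤ cpdDm (cpdPr (cpdPr x y) v) E + 2 := by
  have hs : ({a} : Finset ι) ⊆ E := by simpa using ha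
  have h1 := cpd_two (cpdPr x y) v E _ {a} rfl hs hconn
  have h2 := cpd_two x y E _ {a} rfl hs (cpdConn_left _ _ hconn)
  have hx := cpdDm_le_card x {a}
  have hy := cpdDm_le_card y {a}
  have hv := cpdDm_le_card v {a}
  have hz : 1 ≤ cpdDm (cpdPr (cpdPr x y) v) {a} := by
    unfold cpdDm
    rw [Submodule.one_le_finrank_iff]
    intro hb
    have := cpdMem (cpdPr (cpdPr x y) v) (Finset.mem_singleton_self a)
    rw [hb, mem_bot] at this
    exact h0 this
  simp only [Finset.card_singleton] at hx hy hv
  omega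

/-- The inductive step: sub-relations between two families of rank-one tensors. -/
theorem cpd_match {α β γ P Q : Type*} [Finite α] [Finite β] [Finite γ]
    [DecidableEq P] [DecidableEq Q]
    (x : P ⊕ Q → α → 𝕜) (y : P ⊕ Q → β → 𝕜) (v : P ⊕ Q → γ → 𝕜)
    (h0 : ∀ a, cpdPr (cpdPr x y) v a ≠ 0)
    (hLP : ∀ S : Finset P, 2 ≤ S.card →
      2 * S.card + 2 ≤ cpdDm (fun p => x (Sum.inl p)) S + cpdDm (fun p => y (Sum.inl p)) S
        + cpdDm (fun p => v (Sum.inl p)) S) :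
    ∀ (n : ℕ) (E : Finset (P ⊕ Q)), E.card = n →
      ∑ p ∈ E.toLeft, cpdPr (cpdPr x y) v (Sum.inl p) =
        ∑ q ∈ E.toRight, cpdPr (cpdPr x y) v (Sum.inr q) →
      E.toLeft.card ≤ E.toRight.card ∧
      (E.toLeft.card = E.toRight.card → ∀ p ∈ E.toLeft, ∃ q ∈ E.toRight,
        cpdPr (cpdPr x y) v (Sum.inl p) = cpdPr (cpdPr x y) v (Sum.inr q)) := by
  classical
  set t := cpdPr (cpdPr x y) v with ht
  intro n
  induction n using Nat.strong_induction_on with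
  | _ n ih =>
    intro E hn hsum
    by_cases hE : ∃ P' Q' : Finset (P ⊕ Q), P'.Nonempty ∧ Q'.Nonempty ∧ Disjoint P' Q' ∧
        P' ∪ Q' = E ∧ Disjoint (cpdSp t P') (cpdSp t Q')
    · obtain ⟨P', Q', hP', hQ', hd, hU, hsp⟩ := hE
      have hL : E.toLeft = P'.toLeft ∪ Q'.toLeft := by rw [← hU]; ext; simp
      have hR : E.toRight = P'.toRight ∪ Q'.toRight := by rw [← hU]; ext; simp
      have hdL : Disjoint P'.toLeft Q'.toLeft := by
        rw [Finset.disjoint_left] at hd ⊢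
        intro p h1 h2
        exact hd (Finset.mem_toLeft.1 h1) (Finset.mem_toLeft.1 h2)
      have hdR : Disjoint P'.toRight Q'.toRight := by
        rw [Finset.disjoint_left] at hd ⊢
        intro p h1 h2
        exact hd (Finset.mem_toRight.1 h1) (Finset.mem_toRight.1 h2)
      have hcard : P'.card + Q'.card = n := by
        rw [← hn, ← hU, Finset.card_union_of_disjoint hd]
      have hmemP : ∀ W : Finset (P ⊕ Q), ∑ p ∈ W.toLeft, t (Sum.inl p) -
          ∑ q ∈ W.toRight, t (Sum.inr q) ∈ cpdSp t W := fun W =>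
        sub_mem (sum_mem fun p hp => cpdMem t (Finset.mem_toLeft.1 hp))
          (sum_mem fun p hp => cpdMem t (Finset.mem_toRight.1 hp))
      rw [hL, hR, Finset.sum_union hdL, Finset.sum_union hdR] at hsum
      have hz : ∑ p ∈ P'.toLeft, t (Sum.inl p) - ∑ q ∈ P'.toRight, t (Sum.inr q) = 0 := by
        refine Submodule.disjoint_def.1 hsp _ (hmemP P') ?_
        have : ∑ p ∈ P'.toLeft, t (Sum.inl p) - ∑ q ∈ P'.toRight, t (Sum.inr q) =
            -(∑ p ∈ Q'.toLeft, t (Sum.inl p) - ∑ q ∈ Q'.toRight, t (Sum.inr q)) := by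
          rw [neg_sub, sub_eq_sub_iff_add_eq_add, hsum, add_comm]
        rw [this]
        exact neg_mem (hmemP Q')
      have e1 := sub_eq_zero.1 hz
      have e2 : ∑ p ∈ Q'.toLeft, t (Sum.inl p) = ∑ q ∈ Q'.toRight, t (Sum.inr q) := by
        rw [e1] at hsum
        exact add_left_cancel hsum
      have hp := hP'.card_pos
      have hq := hQ'.card_pos
      obtain ⟨i1, i2⟩ := ih P'.card (by omega) P' rfl e1
      obtain ⟨j1, j2⟩ := ih Q'.card (by omega) Q' rfl e2
      rw [hL, hR, Finset.card_union_of_disjoint hdL, Finset.card_union_of_disjoint hdR]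
      refine ⟨by omega, fun heq p hp => ?_⟩
      rcases Finset.mem_union.1 hp with h | h
      · obtain ⟨q, hq, hqe⟩ := i2 (by omega) p h
        exact ⟨q, Finset.mem_union_left _ hq, hqe⟩
      · obtain ⟨q, hq, hqe⟩ := j2 (by omega) p h
        exact ⟨q, Finset.mem_union_right _ hq, hqe⟩
    · by_cases hlr : E.toLeft.card < E.toRight.card
      · exact ⟨hlr.le, fun h => by omega⟩
      have hEc := Finset.card_toLeft_add_card_toRight (u := E)
      by_cases h2 : 2 ≤ E.toLeft.card
      · exfalso
        obtain ⟨p, hp⟩ : E.toLeft.Nonempty := Finset.card_pos.1 (by omega)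
        have hpE := Finset.mem_toLeft.1 hp
        have hconn : cpdConn t {Sum.inl p} E := by
          intro P' Q' h1 h2 h3 h4 h5
          exact hE ⟨P', Q', ⟨Sum.inl p, h1 (by simp)⟩, h2, h3, h4, h5⟩
        have hthree := cpd_three x y v E (Sum.inl p) hpE (h0 _) hconn
        have hlp := hLP _ h2
        have m1 : cpdDm (fun p => x (Sum.inl p)) E.toLeft ≤ cpdDm x E := by
          apply Submodule.finrank_mono
          refine span_le.2 ?_
          rintro _ ⟨b, hb, rfl⟩
          exact cpdMem x (Finset.mem_toLeft.1 (by exact_mod_cast hb))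
        have m2 : cpdDm (fun p => y (Sum.inl p)) E.toLeft ≤ cpdDm y E := by
          apply Submodule.finrank_mono
          refine span_le.2 ?_
          rintro _ ⟨b, hb, rfl⟩
          exact cpdMem y (Finset.mem_toLeft.1 (by exact_mod_cast hb))
        have m3 : cpdDm (fun p => v (Sum.inl p)) E.toLeft ≤ cpdDm v E := by
          apply Submodule.finrank_mono
          refine span_le.2 ?_
          rintro _ ⟨b, hb, rfl⟩
          exact cpdMem v (Finset.mem_toLeft.1 (by exact_mod_cast hb))
        have hrk : cpdDm t E + 1 ≤ E.card := by
          have hle : cpdDm t E ≤ cpdDm t (E.erase (Sum.inl p)) := by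
            apply Submodule.finrank_mono
            refine span_le.2 ?_
            rintro _ ⟨b, hb, rfl⟩
            have hb' : b ∈ E := by exact_mod_cast hb
            by_cases hbp : b = Sum.inl p
            · subst hbp
              have : t (Sum.inl p) = ∑ q ∈ E.toRight, t (Sum.inr q) -
                  ∑ p' ∈ E.toLeft.erase p, t (Sum.inl p') := by
                rw [← hsum, ← Finset.add_sum_erase _ _ hp]
                simp
              rw [this]
              refine sub_mem (sum_mem fun q hq => cpdMem t ?_) (sum_mem fun q hq => cpdMem t ?_)
              · simpa using hq
              · simpa using hq
            · exact cpdMem t (Finset.mem_erase.2 ⟨hbp, hb'⟩)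
          have := cpdDm_le_card t (E.erase (Sum.inl p))
          have := Finset.card_erase_add_one hpE
          omega
        rw [← ht] at hthree
        omega
      · rcases Nat.eq_zero_or_pos E.toLeft.card with hl | hl
        · refine ⟨by omega, fun _ p hp => ?_⟩
          rw [Finset.card_eq_zero] at hl
          simp [hl] at hp
        · have hl1 : E.toLeft.card = 1 := by omega
          obtain ⟨p, hp⟩ := Finset.card_eq_one.1 hl1
          rcases Nat.eq_zero_or_pos E.toRight.card with hr | hr
          · exfalso
            rw [Finset.card_eq_zero] at hr
            rw [hp, hr] at hsum
            simp at hsum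
            exact h0 _ hsum
          · have hr1 : E.toRight.card = 1 := by omega
            obtain ⟨q, hq⟩ := Finset.card_eq_one.1 hr1
            rw [hp, hq] at hsum ⊢
            simp at hsum ⊢
            exact hsum

/-- Equal nonzero rank-one tensors have proportional factors. -/
theorem cpd_prop {α β γ : Type*} {a a' : α → 𝕜} {b b' : β → 𝕜} {c c' : γ → 𝕜}
    (ha : a ≠ 0) (hb : b ≠ 0) (hc : c ≠ 0)
    (h : ∀ i j k, a i * b j * c k = a' i * b' j * c' k) :
    ∃ la lb lc : 𝕜, la * lb * lc = 1 ∧ (∀ i, a' i = a i * la) ∧ (∀ j, b' j = b j * lb) ∧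
      (∀ k, c' k = c k * lc) := by
  obtain ⟨i, hi⟩ := Function.ne_iff.1 ha
  obtain ⟨j, hj⟩ := Function.ne_iff.1 hb
  obtain ⟨k, hk⟩ := Function.ne_iff.1 hc
  simp only [Pi.zero_apply] at hi hj hk
  have h1 := h i j k
  have hne : a' i * b' j * c' k ≠ 0 := by
    rw [← h1]; exact mul_ne_zero (mul_ne_zero hi hj) hk
  have hi' : a' i ≠ 0 := fun h => hne (by simp [h])
  have hj' : b' j ≠ 0 := fun h => hne (by simp [h])
  have hk' : c' k ≠ 0 := fun h => hne (by simp [h])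
  refine ⟨a' i / a i, b' j / b j, c' k / c k, ?_, fun i' => ?_, fun j' => ?_, fun k' => ?_⟩
  · field_simp
    exact h1.symm
  · have h2 := h i' j k
    field_simp
    apply mul_right_cancel₀ (mul_ne_zero hj' hk')
    apply mul_right_cancel₀ (mul_ne_zero hj hk)
    linear_combination (-(b j * c k * a i)) * h2 + (a i' * b j * c k) * h1
  · have h2 := h i j' k
    field_simp
    apply mul_right_cancel₀ (mul_ne_zero hi' hk')
    apply mul_right_cancel₀ (mul_ne_zero hi hk)
    linear_combination (-(a i * c k * b j)) * h2 + (b j' * a i * c k) * h1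
  · have h2 := h i j k'
    field_simp
    apply mul_right_cancel₀ (mul_ne_zero hi' hj')
    apply mul_right_cancel₀ (mul_ne_zero hi hj)
    linear_combination (-(a i * b j * c k)) * h2 + (c k' * a i * b j) * h1

end KruskalHelpers

section KruskalMain

open Submodule Module

variable {𝕜 : Type*} [RCLike 𝕜]

theorem cpd_rank_sub {I R : ℕ} (A : Matrix (Fin I) (Fin R) 𝕜) (s : Finset (Fin R)) :
    (A.submatrix id (fun x : {y // y ∈ s} => x.1)).rank = cpdDm A.transpose s := by
  rw [Matrix.rank_eq_finrank_span_cols]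
  exact (congrArg (fun V : Submodule 𝕜 (Fin I → 𝕜) => finrank 𝕜 V)
    (cpdSp_eq_range (fun r i => A i r) s)).symm

theorem cpd_rank_univ {I R : ℕ} (A : Matrix (Fin I) (Fin R) 𝕜) :
    A.rank = cpdDm A.transpose Finset.univ := by
  rw [Matrix.rank_eq_finrank_span_cols]
  have h : cpdSp (fun r i => A i r) Finset.univ = span 𝕜 (Set.range fun r i => A i r) := by
    unfold cpdSp
    rw [Finset.coe_univ, Set.image_univ]
  exact (congrArg (fun V : Submodule 𝕜 (Fin I → 𝕜) => finrank 𝕜 V) h).symm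

/-- The rank of a subset of columns is at least the rank minus the number of missing columns. -/
theorem cpd_rank_drop {I R : ℕ} (A : Matrix (Fin I) (Fin R) 𝕜) (s : Finset (Fin R)) :
    A.rank + s.card ≤ cpdDm A.transpose s + R := by
  have h1 := cpdDm_union_le A.transpose s sᶜ
  rw [Finset.union_compl, ← cpd_rank_univ] at h1
  have h2 := cpdDm_le_card A.transpose sᶜ
  have h3 := Finset.card_add_card_compl s
  rw [Fintype.card_fin] at h3
  omega

/-- The Lovitz-Petrov type inequality from two of the (H) conditions. -/
theorem cpd_LP {I J K R : ℕ}
    (A : Matrix (Fin I) (Fin R) 𝕜) (B : Matrix (Fin J) (Fin R) 𝕜) (C : Matrix (Fin K) (Fin R) 𝕜)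
    (h : (CondH (R - A.rank + 2) B C ∧ CondH (R - B.rank + 2) C A) ∨
         (CondH (R - B.rank + 2) C A ∧ CondH (R - C.rank + 2) A B) ∨
         (CondH (R - A.rank + 2) B C ∧ CondH (R - C.rank + 2) A B))
    (S : Finset (Fin R)) (hS : 2 ≤ S.card) :
    2 * S.card + 2 ≤ cpdDm A.transpose S + cpdDm B.transpose S + cpdDm C.transpose S := by
  have hc : S.card ≤ R := by simpa using S.card_le_univ
  have a1 := cpd_rank_drop A S
  have b1 := cpd_rank_drop B S
  have c1 := cpd_rank_drop C S
  have a2 := cpdDm_le_card A.transpose S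
  have b2 := cpdDm_le_card B.transpose S
  have c2 := cpdDm_le_card C.transpose S
  rcases h with ⟨h1, h2⟩ | ⟨h1, h2⟩ | ⟨h1, h2⟩ <;>
  · have h1 := h1 _ (by omega) hc S rfl
    have h2 := h2 _ (by omega) hc S rfl
    rw [cpd_rank_sub, cpd_rank_sub] at h1 h2
    omega

theorem cpd_core {I J K R R' : ℕ} (T : Fin I → Fin J → Fin K → 𝕜)
    (A : Matrix (Fin I) (Fin R) 𝕜) (B : Matrix (Fin J) (Fin R) 𝕜) (C : Matrix (Fin K) (Fin R) 𝕜)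
    (A' : Matrix (Fin I) (Fin R') 𝕜) (B' : Matrix (Fin J) (Fin R') 𝕜)
    (C' : Matrix (Fin K) (Fin R') 𝕜)
    (hPD : IsPD T A B C) (hPD' : IsPD T A' B' C')
    (hLP : ∀ S : Finset (Fin R), 2 ≤ S.card →
      2 * S.card + 2 ≤ cpdDm A.transpose S + cpdDm B.transpose S + cpdDm C.transpose S) :
    R ≤ R' ∧ (R = R' → ∀ p, ∃ q, ∀ i j k,
      A i p * B j p * C k p = A' i q * B' j q * C' k q) := by
  obtain ⟨hA, hB, hC, hT⟩ := hPD
  obtain ⟨hA', hB', hC', hT'⟩ := hPD'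
  let x : Fin R ⊕ Fin R' → Fin I → 𝕜 := Sum.elim A.transpose A'.transpose
  let y : Fin R ⊕ Fin R' → Fin J → 𝕜 := Sum.elim B.transpose B'.transpose
  let v : Fin R ⊕ Fin R' → Fin K → 𝕜 := Sum.elim C.transpose C'.transpose
  have h0 : ∀ a, cpdPr (cpdPr x y) v a ≠ 0 := by
    intro a
    have hx : x a ≠ 0 := by
      rcases a with a | a
      · exact hA a
      · exact hA' a
    have hy : y a ≠ 0 := by
      rcases a with a | a
      · exact hB a
      · exact hB' a
    have hv : v a ≠ 0 := by
      rcases a with a | a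
      · exact hC a
      · exact hC' a
    obtain ⟨i, hi⟩ := Function.ne_iff.1 hx
    obtain ⟨j, hj⟩ := Function.ne_iff.1 hy
    obtain ⟨k, hk⟩ := Function.ne_iff.1 hv
    intro hcon
    have := congrFun hcon ((i, j), k)
    simp only [cpdPr, Pi.zero_apply] at this hi hj hk
    exact mul_ne_zero (mul_ne_zero hi hj) hk this
  have key := cpd_match x y v h0 hLP _ Finset.univ rfl (by
    ext ⟨⟨i, j⟩, k⟩
    have := congrFun (congrFun (congrFun (hT.symm.trans hT') i) j) k
    rw [Finset.toLeft_univ, Finset.toRight_univ, Finset.sum_apply, Finset.sum_apply]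
    exact this)
  simp only [Finset.toLeft_univ, Finset.toRight_univ, Finset.card_univ, Fintype.card_fin] at key
  refine ⟨key.1, fun hR p => ?_⟩
  obtain ⟨q, -, hq⟩ := key.2 hR p (Finset.mem_univ _)
  exact ⟨q, fun i j k => congrFun hq ((i, j), k)⟩

theorem cpd_essential {I J K R : ℕ} (T : Fin I → Fin J → Fin K → 𝕜)
    (A A' : Matrix (Fin I) (Fin R) 𝕜) (B B' : Matrix (Fin J) (Fin R) 𝕜)
    (C C' : Matrix (Fin K) (Fin R) 𝕜)
    (hPD : IsPD T A B C) (hPD' : IsPD T A' B' C')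
    (hLP : ∀ S : Finset (Fin R), 2 ≤ S.card →
      2 * S.card + 2 ≤ cpdDm A.transpose S + cpdDm B.transpose S + cpdDm C.transpose S) :
    ∃ σ : Equiv.Perm (Fin R), ∀ r i j k,
      A i r * B j r * C k r = A' i (σ r) * B' j (σ r) * C' k (σ r) := by
  classical
  choose f hf using (cpd_core T A B C A' B' C' hPD hPD' hLP).2 rfl
  have hinj : Function.Injective f := by
    intro p q hpq
    by_contra hne
    obtain ⟨la, lb, lc, -, h1, -, -⟩ := cpd_prop (a := A.transpose p) (a' := A.transpose q)
      (b := B.transpose p) (b' := B.transpose q) (c := C.transpose p) (c' := C.transpose q)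
      (hPD.1 p) (hPD.2.1 p) (hPD.2.2.1 p)
      (fun i j k => by
        simp only [Matrix.transpose_apply]
        rw [hf p i j k, hf q i j k, hpq])
    have hcard : ({p, q} : Finset (Fin R)).card = 2 := Finset.card_pair hne
    have hl := hLP {p, q} hcard.ge
    have hb := cpdDm_le_card B.transpose {p, q}
    have hc := cpdDm_le_card C.transpose {p, q}
    have ha : cpdDm A.transpose {p, q} ≤ cpdDm A.transpose {p} := by
      apply Submodule.finrank_mono
      refine span_le.2 ?_
      rintro _ ⟨b, hb, rfl⟩
      simp only [Finset.coe_insert, Finset.coe_singleton, Set.mem_insert_iff,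
        Set.mem_singleton_iff] at hb
      have hp : A.transpose p ∈ cpdSp A.transpose {p} := cpdMem _ (by simp)
      rcases hb with rfl | rfl
      · exact hp
      · have : A.transpose b = la • A.transpose p := by
          ext i
          rw [h1 i, Pi.smul_apply, smul_eq_mul, mul_comm]
        rw [this]
        exact smul_mem _ _ hp
    have ha' := cpdDm_le_card A.transpose {p}
    rw [Finset.card_singleton] at ha'
    omega
  exact ⟨Equiv.ofBijective f (Finite.injective_iff_bijective.1 hinj), hf⟩

end KruskalMain

/-- Corollary 1.18: uniqueness of the CPD when at least two of the
conditions (H m_A), (H m_B), (H m_C) hold. -/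
theorem stmt_7 {I J K R : ℕ} (T : Fin I → Fin J → Fin K → F)
    (A : Matrix (Fin I) (Fin R) F) (B : Matrix (Fin J) (Fin R) F) (C : Matrix (Fin K) (Fin R) F)
    (hPD : IsPD T A B C)
    (h : (CondH (R - A.rank + 2) B C ∧ CondH (R - B.rank + 2) C A) ∨
         (CondH (R - B.rank + 2) C A ∧ CondH (R - C.rank + 2) A B) ∨
         (CondH (R - A.rank + 2) B C ∧ CondH (R - C.rank + 2) A B)) :
    tensorRank T = R ∧ CPDUnique T R := by
  have hLP := cpd_LP A B C h
  refine ⟨le_antisymm (Nat.sInf_le ⟨A, B, C, hPD⟩) ?_, ?_⟩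
  · refine le_csInf ⟨R, A, B, C, hPD⟩ ?_
    rintro R' ⟨A', B', C', hPD'⟩
    exact (cpd_core T A B C A' B' C' hPD hPD' hLP).1
  · intro A₁ A₂ B₁ B₂ C₁ C₂ h₁ h₂
    obtain ⟨σ, hσ⟩ := cpd_essential T A A₁ B B₁ C C₁ hPD h₁ hLP
    obtain ⟨τ, hτ⟩ := cpd_essential T A A₂ B B₂ C C₂ hPD h₂ hLP
    have hprop : ∀ r, ∃ la lb lc : F, la * lb * lc = 1 ∧
        (∀ i, A₂ i r = A₁ i (σ (τ.symm r)) * la) ∧ (∀ j, B₂ j r = B₁ j (σ (τ.symm r)) * lb) ∧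
        (∀ k, C₂ k r = C₁ k (σ (τ.symm r)) * lc) := by
      intro r
      refine cpd_prop (a := A₁.transpose (σ (τ.symm r))) (a' := A₂.transpose r)
        (b := B₁.transpose (σ (τ.symm r))) (b' := B₂.transpose r)
        (c := C₁.transpose (σ (τ.symm r))) (c' := C₂.transpose r)
        (h₁.1 _) (h₁.2.1 _) (h₁.2.2.1 _) (fun i j k => ?_)
      have e1 := hσ (τ.symm r) i j k
      have e2 := hτ (τ.symm r) i j k
      rw [Equiv.apply_symm_apply] at e2
      exact e1.symm.trans e2
    choose la lb lc h1 h2 h3 h4 using hprop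
    exact ⟨τ.symm.trans σ, la, lb, lc, h1, fun i r => h2 r i, fun j r => h3 r j,
      fun k r => h4 r k⟩
end

section
/- Let T = [A,B,C]_R with A ∈ F^{I×R}, B ∈ F^{J×R}, C ∈ F^{K×R}, and let (X,Y,Z) be one of the cyclic permutations (A,B,C), (B,C,A), (C,A,B). If k_X + r_Y + r_Z ≥ 2R + 2 and min(r_Z + k_Y, k_Z + r_Y) ≥ R + 2, then r_T = R and the CPD of T is unique. -/
open scoped Matrix
open MeasureTheory

variable {F : Type*} [RCLike F]

open Module Submodule
open scoped TensorProduct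

section KruskalAux
variable {𝕂 : Type*} [Field 𝕂] {ι : Type*}

theorem kr_finrank_sup {V : Type*} [AddCommGroup V] [Module 𝕂 V] [FiniteDimensional 𝕂 V]
    (U P : Submodule 𝕂 V) :
    finrank 𝕂 (P.map U.mkQ) + finrank 𝕂 U = finrank 𝕂 (U ⊔ P : Submodule 𝕂 V) := by
  have h := LinearMap.finrank_range_add_finrank_ker (U.mkQ.domRestrict P)
  rw [LinearMap.range_domRestrict, LinearMap.ker_domRestrict] at h
  have h2 := Submodule.finrank_sup_add_finrank_inf_eq U P
  have h3 : finrank 𝕂 (Submodule.comap P.subtype (LinearMap.ker U.mkQ)) =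
      finrank 𝕂 (U ⊓ P : Submodule 𝕂 V) := by
    rw [Submodule.ker_mkQ]
    rw [LinearEquiv.finrank_eq (P.equivSubtypeMap (Submodule.comap P.subtype U)),
      Submodule.map_comap_subtype, inf_comm]
  have h4 : finrank 𝕂 ((LinearMap.ker U.mkQ).submoduleOf P) =
      finrank 𝕂 (U ⊓ P : Submodule 𝕂 V) := h3
  omega

/-- Orthogonality bound. -/
theorem kr_orth {X W : Type*} [AddCommGroup X] [Module 𝕂 X] [FiniteDimensional 𝕂 X]
    [AddCommGroup W] [Module 𝕂 W] [FiniteDimensional 𝕂 W]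
    (T : Finset ι) (x : ι → X) (w : ι → W)
    (h : ∀ f : Dual 𝕂 X, ∑ a ∈ T, f (x a) • w a = 0) :
    finrank 𝕂 (span 𝕂 (x '' T)) + finrank 𝕂 (span 𝕂 (w '' T)) ≤ T.card := by
  classical
  let Φ : (T → 𝕂) →ₗ[𝕂] W := Fintype.linearCombination 𝕂 (fun a : T => w a)
  let Ψ : Dual 𝕂 X →ₗ[𝕂] (T → 𝕂) := LinearMap.pi (fun a : T => Dual.eval 𝕂 X (x a))
  have hΦ : LinearMap.range Φ = span 𝕂 (w '' T) := by
    rw [Fintype.range_linearCombination]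
    congr 1
    ext v; simp
  have hΨ : LinearMap.ker Ψ = (span 𝕂 (x '' T)).dualAnnihilator := by
    ext f
    rw [Submodule.mem_dualAnnihilator, LinearMap.mem_ker]
    constructor
    · intro hf v hv
      have : span 𝕂 (x '' T) ≤ LinearMap.ker f := by
        rw [span_le]
        rintro _ ⟨a, ha, rfl⟩
        exact congrFun hf ⟨a, ha⟩
      exact this hv
    · intro hf
      ext a
      exact hf _ (subset_span ⟨a, a.2, rfl⟩)
  have hle : LinearMap.range Ψ ≤ LinearMap.ker Φ := by
    rintro _ ⟨f, rfl⟩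
    rw [LinearMap.mem_ker, Fintype.linearCombination_apply, ← h f]
    exact Finset.sum_coe_sort T (fun a => f (x a) • w a)
  have h1 := LinearMap.finrank_range_add_finrank_ker Φ
  have h2 := LinearMap.finrank_range_add_finrank_ker Ψ
  have h3 := Subspace.finrank_add_finrank_dualAnnihilator_eq (span 𝕂 (x '' T))
  have h4 := Submodule.finrank_mono hle
  rw [hΦ] at h1
  rw [hΨ, Subspace.dual_finrank_eq] at h2
  simp only [finrank_fintype_fun_eq_card, Fintype.card_coe] at h1
  omega

theorem kr_orth_mod {X W : Type*} [AddCommGroup X] [Module 𝕂 X] [FiniteDimensional 𝕂 X]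
    [AddCommGroup W] [Module 𝕂 W] [FiniteDimensional 𝕂 W]
    (T : Finset ι) (x : ι → X) (w : ι → W) (U : Submodule 𝕂 X)
    (h : ∀ f : Dual 𝕂 X, (∀ u ∈ U, f u = 0) → ∑ a ∈ T, f (x a) • w a = 0) :
    finrank 𝕂 (U ⊔ span 𝕂 (x '' T) : Submodule 𝕂 X) + finrank 𝕂 (span 𝕂 (w '' T))
      ≤ T.card + finrank 𝕂 U := by
  have h1 := kr_finrank_sup U (span 𝕂 (x '' T))
  have h2 := kr_orth T (fun a => U.mkQ (x a)) w (fun f => h (f ∘ₗ U.mkQ) (by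
    intro u hu
    simp [(Submodule.Quotient.mk_eq_zero U).2 hu]))
  rw [Submodule.map_span, ← Set.image_comp] at h1
  have h3 : (fun a => U.mkQ (x a)) = U.mkQ ∘ x := rfl
  rw [h3] at h2
  omega

theorem kr_tensor_sep {Y Z : Type*} [AddCommGroup Y] [Module 𝕂 Y] [FiniteDimensional 𝕂 Y]
    [AddCommGroup Z] [Module 𝕂 Z] [FiniteDimensional 𝕂 Z] (T : Finset ι)
    (y : ι → Y) (z : ι → Z) :
    (∑ a ∈ T, y a ⊗ₜ[𝕂] z a = 0) ↔ ∀ f : Dual 𝕂 Y, ∑ a ∈ T, f (y a) • z a = 0 := by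
  constructor
  · intro h f
    have := congrArg ((TensorProduct.lid 𝕂 Z).toLinearMap ∘ₗ TensorProduct.map f LinearMap.id) h
    simpa using this
  · intro h
    have b := Module.finBasis 𝕂 Y
    have c := Module.finBasis 𝕂 Z
    apply (b.tensorProduct c).ext_elem
    rintro ⟨i, j⟩
    have := congrArg (c.coord j) (h (b.coord i))
    simpa [Finsupp.finsetSum_apply, mul_comm] using this

theorem kr_tensor_symm {Y Z : Type*} [AddCommGroup Y] [Module 𝕂 Y] [FiniteDimensional 𝕂 Y]
    [AddCommGroup Z] [Module 𝕂 Z] [FiniteDimensional 𝕂 Z] (T : Finset ι)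
    (y : ι → Y) (z : ι → Z) :
    (∑ a ∈ T, y a ⊗ₜ[𝕂] z a = 0) ↔ (∑ a ∈ T, z a ⊗ₜ[𝕂] y a = 0) := by
  rw [← (TensorProduct.comm 𝕂 Y Z).map_eq_zero_iff]
  simp

theorem kr_span_smul {Y : Type*} [AddCommGroup Y] [Module 𝕂 Y] (T : Finset ι) (y : ι → Y)
    (μ : ι → 𝕂) (hμ : ∀ a ∈ T, μ a ≠ 0) :
    span 𝕂 ((fun a => μ a • y a) '' T) = span 𝕂 (y '' T) := by
  apply le_antisymm
  · rw [span_le]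
    rintro _ ⟨a, ha, rfl⟩
    exact smul_mem _ _ (subset_span ⟨a, ha, rfl⟩)
  · rw [span_le]
    rintro _ ⟨a, ha, rfl⟩
    have h : μ a • y a ∈ span 𝕂 ((fun a => μ a • y a) '' (T : Set ι)) :=
      subset_span ⟨a, ha, rfl⟩
    have h2 := smul_mem _ (μ a)⁻¹ h
    rwa [smul_smul, inv_mul_cancel₀ (hμ a ha), one_smul] at h2

theorem kr_span_union {Y : Type*} [AddCommGroup Y] [Module 𝕂 Y] [DecidableEq ι] (S T : Finset ι)
    (y : ι → Y) :
    span 𝕂 (y '' (S ∪ T : Finset ι)) = span 𝕂 (y '' S) ⊔ span 𝕂 (y '' T) := by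
  rw [Finset.coe_union, Set.image_union, span_union]

/-- minimal dependent extension -/
theorem kr_rank_step [DecidableEq ι] {V : Type*} [AddCommGroup V] [Module 𝕂 V]
    [FiniteDimensional 𝕂 V] (w : ι → V) (U : Submodule 𝕂 V) (M : Finset ι) (l : ι → 𝕂)
    (h1 : ∑ a ∈ M, l a • w a ∈ U) (h2 : ∑ a ∈ M, l a • w a ≠ 0) :
    ∃ T ⊆ M, T.Nonempty ∧ ∃ μ : ι → 𝕂, (∀ a ∈ T, μ a ≠ 0) ∧ ∑ a ∈ T, μ a • w a ∈ U ∧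
      ∑ a ∈ T, μ a • w a ≠ 0 ∧
      finrank 𝕂 U + T.card ≤ finrank 𝕂 (U ⊔ span 𝕂 (w '' T) : Submodule 𝕂 V) + 1 := by
  classical
  let P : Finset ι → Prop := fun T => ∃ μ : ι → 𝕂, ∑ a ∈ T, μ a • w a ∈ U ∧
      ∑ a ∈ T, μ a • w a ≠ 0
  obtain ⟨T, hT, hmin⟩ := Finset.exists_min_image (M.powerset.filter P) Finset.card
    ⟨M, by simp only [Finset.mem_filter, Finset.mem_powerset]; exact ⟨subset_rfl, l, h1, h2⟩⟩
  simp only [Finset.mem_filter, Finset.mem_powerset] at hT hmin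
  obtain ⟨hTM, μ, hμU, hμ0⟩ := hT
  have key : ∀ t ∈ T, ∀ ν : ι → 𝕂, ∑ a ∈ T.erase t, ν a • w a ∈ U →
      ∑ a ∈ T.erase t, ν a • w a = 0 := by
    intro t ht ν hν
    by_contra h0
    have := hmin (T.erase t) ⟨(Finset.erase_subset _ _).trans hTM, ν, hν, h0⟩
    have := Finset.card_erase_lt_of_mem ht
    omega
  have hμne : ∀ a ∈ T, μ a ≠ 0 := by
    intro a ha h0
    have : ∑ a ∈ T, μ a • w a = ∑ a ∈ T.erase a, μ a • w a := by
      rw [← Finset.add_sum_erase T _ ha, h0, zero_smul, zero_add]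
    exact hμ0 (this ▸ key a ha μ (this ▸ hμU))
  have hTne : T.Nonempty := by
    rw [Finset.nonempty_iff_ne_empty]
    rintro rfl
    simp at hμ0
  refine ⟨T, hTM, hTne, μ, hμne, hμU, hμ0, ?_⟩
  obtain ⟨t, ht⟩ := hTne
  have hli : LinearIndependent 𝕂 (fun a : (T.erase t) => U.mkQ (w a)) := by
    rw [Fintype.linearIndependent_iff]
    intro g hg
    let ν : ι → 𝕂 := fun i => if h : i ∈ T.erase t then g ⟨i, h⟩ else 0
    have hsum : ∑ a ∈ T.erase t, ν a • w a = ∑ a : (T.erase t), g a • w a := by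
      rw [← Finset.sum_coe_sort]
      apply Finset.sum_congr rfl
      intro a _
      simp only [ν]
      rw [dif_pos a.2]
    have hU : ∑ a ∈ T.erase t, ν a • w a ∈ U := by
      rw [hsum, ← Submodule.ker_mkQ U, LinearMap.mem_ker, map_sum, ← hg]
      simp
    have h0 := key t ht ν hU
    intro b
    by_contra hb
    have hbT : (b : ι) ∈ T := Finset.mem_of_mem_erase b.2
    have hνb : ν b = g b := by simp only [ν]; rw [dif_pos b.2]
    have hνt : ν t = 0 := by simp [ν]
    have h0T : ∑ a ∈ T, ν a • w a = 0 := by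
      rw [← Finset.add_sum_erase T _ ht, hνt, zero_smul, zero_add, h0]
    have hx : ∑ a ∈ T.erase b, (μ a - μ b / ν b * ν a) • w a = ∑ a ∈ T, μ a • w a := by
      have : ∑ a ∈ T, (μ a - μ b / ν b * ν a) • w a = ∑ a ∈ T, μ a • w a := by
        simp only [sub_smul, mul_smul, Finset.sum_sub_distrib, ← Finset.smul_sum, h0T,
          smul_zero, sub_zero]
      rw [← this, ← Finset.add_sum_erase T _ hbT, div_mul_cancel₀ _ (by rw [hνb]; exact hb),
        sub_self, zero_smul, zero_add]
    exact hμ0 (hx ▸ key b hbT _ (hx ▸ hμU))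
  have hc := finrank_span_eq_card hli
  rw [Fintype.card_coe, Finset.card_erase_of_mem ht] at hc
  have hs := kr_finrank_sup U (span 𝕂 (w '' T))
  have hle : span 𝕂 (Set.range (fun a : (T.erase t) => U.mkQ (w a))) ≤
      (span 𝕂 (w '' T)).map U.mkQ := by
    rw [span_le]
    rintro _ ⟨a, rfl⟩
    exact Submodule.mem_map_of_mem (subset_span ⟨a, Finset.mem_of_mem_erase a.2, rfl⟩)
  have := Submodule.finrank_mono hle
  have := Finset.card_pos.2 ⟨t, ht⟩
  omega

section two
variable {Y Z : Type*} [AddCommGroup Y] [Module 𝕂 Y] [FiniteDimensional 𝕂 Y]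
    [AddCommGroup Z] [Module 𝕂 Z] [FiniteDimensional 𝕂 Z]

theorem kr_kill_left (S T : Finset ι) (y : ι → Y) (z : ι → Z) (μ : ι → 𝕂)
    (h : ∑ a ∈ T, μ a • (y a ⊗ₜ[𝕂] z a) ∈ span 𝕂 ((fun a => y a ⊗ₜ[𝕂] z a) '' S))
    (f : Dual 𝕂 Y) (hf : ∀ u ∈ span 𝕂 (y '' S), f u = 0) :
    ∑ a ∈ T, f (y a) • (μ a • z a) = 0 := by
  let L : Y ⊗[𝕂] Z →ₗ[𝕂] Z := (TensorProduct.lid 𝕂 Z).toLinearMap ∘ₗ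
    TensorProduct.map f LinearMap.id
  have hL : span 𝕂 ((fun a => y a ⊗ₜ[𝕂] z a) '' S) ≤ LinearMap.ker L := by
    rw [span_le]
    rintro _ ⟨a, ha, rfl⟩
    have := hf (y a) (subset_span ⟨a, ha, rfl⟩)
    simp [L, this]
  have h2 : L _ = 0 := hL h
  rw [← h2]
  simp [L, smul_smul, mul_comm]

theorem kr_kill_right (S T : Finset ι) (y : ι → Y) (z : ι → Z) (μ : ι → 𝕂)
    (h : ∑ a ∈ T, μ a • (y a ⊗ₜ[𝕂] z a) ∈ span 𝕂 ((fun a => y a ⊗ₜ[𝕂] z a) '' S))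
    (f : Dual 𝕂 Z) (hf : ∀ u ∈ span 𝕂 (z '' S), f u = 0) :
    ∑ a ∈ T, f (z a) • (μ a • y a) = 0 := by
  let L : Y ⊗[𝕂] Z →ₗ[𝕂] Y := (TensorProduct.rid 𝕂 Y).toLinearMap ∘ₗ
    TensorProduct.map LinearMap.id f
  have hL : span 𝕂 ((fun a => y a ⊗ₜ[𝕂] z a) '' S) ≤ LinearMap.ker L := by
    rw [span_le]
    rintro _ ⟨a, ha, rfl⟩
    have := hf (z a) (subset_span ⟨a, ha, rfl⟩)
    simp [L, this]
  have h2 : L _ = 0 := hL h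
  rw [← h2]
  simp [L, smul_smul, mul_comm]

theorem kr_step [DecidableEq ι] (S N : Finset ι) (hSN : S ⊆ N) (y : ι → Y) (z : ι → Z)
    (l : ι → 𝕂) (hN : ∑ a ∈ N, l a • (y a ⊗ₜ[𝕂] z a) = 0)
    (hS : ∑ a ∈ S, l a • (y a ⊗ₜ[𝕂] z a) ≠ 0) :
    ∃ T ⊆ N \ S, T.Nonempty ∧
      finrank 𝕂 (span 𝕂 (y '' (S ∪ T : Finset ι))) + finrank 𝕂 (span 𝕂 (z '' (S ∪ T : Finset ι)))
        + 1 ≤ finrank 𝕂 (span 𝕂 (y '' S)) + finrank 𝕂 (span 𝕂 (z '' S)) + T.card ∧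
      finrank 𝕂 (span 𝕂 ((fun a => y a ⊗ₜ[𝕂] z a) '' S)) + T.card ≤
        finrank 𝕂 (span 𝕂 ((fun a => y a ⊗ₜ[𝕂] z a) '' (S ∪ T : Finset ι))) + 1 := by
  have hsum := Finset.sum_sdiff (f := fun a => l a • (y a ⊗ₜ[𝕂] z a)) hSN
  rw [hN] at hsum
  have hneg : ∑ a ∈ N \ S, l a • (y a ⊗ₜ[𝕂] z a) = - ∑ a ∈ S, l a • (y a ⊗ₜ[𝕂] z a) :=
    eq_neg_of_add_eq_zero_left hsum
  obtain ⟨T, hT, hTne, μ, hμ, hμU, hμ0, hr⟩ := kr_rank_step (fun a => y a ⊗ₜ[𝕂] z a)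
    (span 𝕂 ((fun a => y a ⊗ₜ[𝕂] z a) '' S)) (N \ S) l
    (by
      rw [hneg]
      exact neg_mem (sum_mem fun a ha => smul_mem _ _ (subset_span ⟨a, ha, rfl⟩)))
    (by rw [hneg]; exact neg_ne_zero.2 hS)
  refine ⟨T, hT, hTne, ?_, ?_⟩
  · rw [kr_span_union, kr_span_union]
    have h2 := kr_orth_mod T z (fun a => μ a • y a) (span 𝕂 (z '' S))
      (kr_kill_right S T y z μ hμU)
    rw [kr_span_smul T y μ hμ] at h2
    have h3 : ¬ Disjoint (span 𝕂 (y '' S)) (span 𝕂 (y '' T)) := by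
      intro hd
      obtain ⟨C, hC, hc⟩ := hd.exists_isCompl
      apply hμ0
      have : ∑ a ∈ T, y a ⊗ₜ[𝕂] (μ a • z a) = 0 := by
        rw [kr_tensor_sep]
        intro f
        have := kr_kill_left S T y z μ hμU
          (f ∘ₗ (span 𝕂 (y '' T)).subtype ∘ₗ
            Submodule.projectionOnto (span 𝕂 (y '' T)) C hc.symm) (by
              intro u hu
              have : Submodule.projectionOnto (span 𝕂 (y '' T)) C hc.symm u = 0 := by
                rw [← LinearMap.mem_ker]
                simpa using hC hu
              simp [this])
        rw [← this]
        apply Finset.sum_congr rfl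
        intro a ha
        have hm : y a ∈ span 𝕂 (y '' T) := subset_span ⟨a, ha, rfl⟩
        rw [LinearMap.comp_apply, LinearMap.comp_apply,
          Submodule.projectionOnto_apply_of_mem_left _ hm]
        rfl
      simpa using this
    have h4 := Submodule.finrank_sup_add_finrank_inf_eq (span 𝕂 (y '' S)) (span 𝕂 (y '' T))
    have h5 : finrank 𝕂 (span 𝕂 (y '' S) ⊓ span 𝕂 (y '' T) : Submodule 𝕂 Y) ≠ 0 := by
      rw [Ne, Submodule.finrank_eq_zero]
      rwa [disjoint_iff] at h3
    omega
  · rw [kr_span_union]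
    exact hr

theorem kr_two [DecidableEq ι] (N : Finset ι) (hNne : N.Nonempty) (y : ι → Y) (z : ι → Z)
    (hy : ∀ a ∈ N, y a ≠ 0) (hz : ∀ a ∈ N, z a ≠ 0)
    (hconn : ∀ S ⊆ N, S.Nonempty → S ≠ N → ∃ l : ι → 𝕂,
      ∑ a ∈ N, l a • (y a ⊗ₜ[𝕂] z a) = 0 ∧ ∑ a ∈ S, l a • (y a ⊗ₜ[𝕂] z a) ≠ 0) :
    finrank 𝕂 (span 𝕂 (y '' N)) + finrank 𝕂 (span 𝕂 (z '' N)) ≤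
      finrank 𝕂 (span 𝕂 ((fun a => y a ⊗ₜ[𝕂] z a) '' N)) + 1 := by
  classical
  let P : Finset ι → Prop := fun S => S.Nonempty ∧
    finrank 𝕂 (span 𝕂 (y '' S)) + finrank 𝕂 (span 𝕂 (z '' S)) ≤
      finrank 𝕂 (span 𝕂 ((fun a => y a ⊗ₜ[𝕂] z a) '' S)) + 1
  obtain ⟨a, ha⟩ := hNne
  have hP : P {a} := by
    refine ⟨⟨a, by simp⟩, ?_⟩
    rw [Finset.coe_singleton, Set.image_singleton, Set.image_singleton, Set.image_singleton]
    have hya := hy a ha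
    have hza := hz a ha
    have hw : y a ⊗ₜ[𝕂] z a ≠ 0 := by
      intro h0
      have h1 := (kr_tensor_sep {a} y z).1 (by simpa using h0)
      simp only [Finset.sum_singleton, smul_eq_zero, hza, or_false] at h1
      exact hya ((Module.forall_dual_apply_eq_zero_iff 𝕂 _).1 h1)
    rw [finrank_span_singleton hya, finrank_span_singleton hza, finrank_span_singleton hw]
  obtain ⟨S, hS, hmax⟩ := Finset.exists_max_image (N.powerset.filter P) Finset.card
    ⟨{a}, by
      simp only [Finset.mem_filter, Finset.mem_powerset]
      exact ⟨by simpa using ha, hP⟩⟩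
  simp only [Finset.mem_filter, Finset.mem_powerset] at hS hmax
  obtain ⟨hSN, hSne, hSP⟩ := hS
  by_cases hEq : S = N
  · rw [← hEq]; exact hSP
  exfalso
  obtain ⟨l, hl1, hl2⟩ := hconn S hSN hSne hEq
  obtain ⟨T, hT, hTne, h1, h2⟩ := kr_step S N hSN y z l hl1 hl2
  have hd : Disjoint S T := by
    rw [Finset.disjoint_left]
    intro b hb hbT
    exact (Finset.mem_sdiff.1 (hT hbT)).2 hb
  have h3 := hmax (S ∪ T) ⟨Finset.union_subset hSN (hT.trans Finset.sdiff_subset),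
    hSne.mono Finset.subset_union_left, by omega⟩
  rw [Finset.card_union_of_disjoint hd] at h3
  have := hTne.card_pos
  omega

theorem kr_three [DecidableEq ι] {X : Type*} [AddCommGroup X] [Module 𝕂 X]
    [FiniteDimensional 𝕂 X] (N : Finset ι) (hNne : N.Nonempty)
    (x : ι → X) (y : ι → Y) (z : ι → Z)
    (hy : ∀ a ∈ N, y a ≠ 0) (hz : ∀ a ∈ N, z a ≠ 0)
    (h0 : ∑ a ∈ N, x a ⊗ₜ[𝕂] (y a ⊗ₜ[𝕂] z a) = 0)
    (hmin : ∀ S ⊆ N, S.Nonempty → S ≠ N → ∑ a ∈ S, x a ⊗ₜ[𝕂] (y a ⊗ₜ[𝕂] z a) ≠ 0) :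
    finrank 𝕂 (span 𝕂 (x '' N)) + finrank 𝕂 (span 𝕂 (y '' N)) + finrank 𝕂 (span 𝕂 (z '' N))
      ≤ N.card + 1 := by
  rw [kr_tensor_sep] at h0
  have h1 := kr_orth N x (fun a => y a ⊗ₜ[𝕂] z a) h0
  have h2 := kr_two N hNne y z hy hz (by
    intro S hS hSne hSN
    have h := hmin S hS hSne hSN
    rw [Ne, kr_tensor_sep] at h
    push Not at h
    obtain ⟨f, hf⟩ := h
    exact ⟨fun a => f (x a), h0 f, hf⟩)
  omega
end two
end KruskalAux

section KruskalMain
variable {𝕂 : Type*} [Field 𝕂]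

theorem kr_main {α β X Y Z : Type*} [DecidableEq α] [DecidableEq β]
    [AddCommGroup X] [Module 𝕂 X] [FiniteDimensional 𝕂 X]
    [AddCommGroup Y] [Module 𝕂 Y] [FiniteDimensional 𝕂 Y]
    [AddCommGroup Z] [Module 𝕂 Z] [FiniteDimensional 𝕂 Z]
    (x : α → X) (y : α → Y) (z : α → Z) (x' : β → X) (y' : β → Y) (z' : β → Z)
    (hx : ∀ a, x a ≠ 0) (hy : ∀ a, y a ≠ 0) (hz : ∀ a, z a ≠ 0)
    (hy' : ∀ a, y' a ≠ 0) (hz' : ∀ a, z' a ≠ 0)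
    (H : ∀ S : Finset α, 2 ≤ S.card → 2 * S.card + 2 ≤ finrank 𝕂 (span 𝕂 (x '' S)) +
      finrank 𝕂 (span 𝕂 (y '' S)) + finrank 𝕂 (span 𝕂 (z '' S))) (n : ℕ) :
    ∀ N : Finset (α ⊕ β), N.card = n →
      ∑ a ∈ N, (Sum.elim x (fun b => - x' b) a) ⊗ₜ[𝕂]
        ((Sum.elim y y' a) ⊗ₜ[𝕂] (Sum.elim z z' a)) = 0 →
      N.toLeft.card ≤ N.toRight.card ∧ (N.toLeft.card = N.toRight.card →
        N.toLeft.val.map (fun a => x a ⊗ₜ[𝕂] (y a ⊗ₜ[𝕂] z a)) =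
        N.toRight.val.map (fun a => x' a ⊗ₜ[𝕂] (y' a ⊗ₜ[𝕂] z' a))) := by
  induction n using Nat.strong_induction_on with
  | _ n ih =>
  intro N hN h0
  by_cases hne : N.Nonempty
  swap
  · rw [Finset.not_nonempty_iff_eq_empty] at hne
    subst hne
    have e1 : (∅ : Finset (α ⊕ β)).toLeft = ∅ := rfl
    have e2 : (∅ : Finset (α ⊕ β)).toRight = ∅ := rfl
    rw [e1, e2]
    exact ⟨le_rfl, fun _ => rfl⟩
  by_cases hmin : ∀ S ⊆ N, S.Nonempty → S ≠ N → ∑ a ∈ S, (Sum.elim x (fun b => - x' b) a) ⊗ₜ[𝕂]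
        ((Sum.elim y y' a) ⊗ₜ[𝕂] (Sum.elim z z' a)) ≠ 0
  · have h3 := kr_three N hne _ _ _ (by rintro (a | a) _; exacts [hy a, hy' a])
      (by rintro (a | a) _; exacts [hz a, hz' a]) h0 hmin
    have hcard := Finset.card_toLeft_add_card_toRight (u := N)
    by_cases hlt : N.toLeft.card < N.toRight.card
    · exact ⟨hlt.le, fun h => absurd h hlt.ne⟩
    push Not at hlt
    have hX : finrank 𝕂 (span 𝕂 (x '' N.toLeft)) ≤
          finrank 𝕂 (span 𝕂 (Sum.elim x (fun b => - x' b) '' N)) := by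
      apply Submodule.finrank_mono
      apply span_mono
      rintro _ ⟨a, ha, rfl⟩
      exact ⟨Sum.inl a, by simpa using ha, rfl⟩
    have hY : finrank 𝕂 (span 𝕂 (y '' N.toLeft)) ≤
          finrank 𝕂 (span 𝕂 (Sum.elim y y' '' N)) := by
      apply Submodule.finrank_mono
      apply span_mono
      rintro _ ⟨a, ha, rfl⟩
      exact ⟨Sum.inl a, by simpa using ha, rfl⟩
    have hZ : finrank 𝕂 (span 𝕂 (z '' N.toLeft)) ≤
          finrank 𝕂 (span 𝕂 (Sum.elim z z' '' N)) := by
      apply Submodule.finrank_mono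
      apply span_mono
      rintro _ ⟨a, ha, rfl⟩
      exact ⟨Sum.inl a, by simpa using ha, rfl⟩
    have hle1 : N.toLeft.card ≤ 1 := by
      by_contra hc
      have := H N.toLeft (by omega)
      omega
    have hpos := hne.card_pos
    have hl1 : N.toLeft.card = 1 := by omega
    obtain ⟨a, ha⟩ := Finset.card_eq_one.1 hl1
    have hNd : N = N.toLeft.disjSum N.toRight := Finset.toLeft_disjSum_toRight.symm
    rw [hNd, Finset.sum_disjSum, ha] at h0
    simp only [Finset.sum_singleton, Sum.elim_inl, Sum.elim_inr] at h0
    have hr : N.toRight.card = 1 := by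
      by_contra hr
      have : N.toRight = ∅ := by
        rw [← Finset.card_eq_zero]; omega
      rw [this] at h0
      simp only [Finset.sum_empty, add_zero] at h0
      have e1 := (kr_tensor_sep {a} x (fun a => y a ⊗ₜ[𝕂] z a)).1 (by simpa using h0)
      have e2 : y a ⊗ₜ[𝕂] z a ≠ 0 := by
        intro h0
        have h1 := (kr_tensor_sep {a} y z).1 (by simpa using h0)
        simp only [Finset.sum_singleton, smul_eq_zero, hz a, or_false] at h1
        exact hy a ((Module.forall_dual_apply_eq_zero_iff 𝕂 _).1 h1)
      simp only [Finset.sum_singleton, smul_eq_zero, e2, or_false] at e1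
      exact hx a ((Module.forall_dual_apply_eq_zero_iff 𝕂 _).1 e1)
    obtain ⟨b, hb⟩ := Finset.card_eq_one.1 hr
    refine ⟨by omega, fun _ => ?_⟩
    rw [hb] at h0
    rw [ha, hb]
    simp only [Finset.sum_singleton, TensorProduct.neg_tmul] at h0
    have h1 := eq_of_sub_eq_zero ((sub_eq_add_neg _ _).trans h0)
    simp [h1]
  · push Not at hmin
    obtain ⟨S, hSN, hSne, hS, hS0⟩ := hmin
    have hsum := Finset.sum_sdiff (f := fun a => (Sum.elim x (fun b => - x' b) a) ⊗ₜ[𝕂]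
        ((Sum.elim y y' a) ⊗ₜ[𝕂] (Sum.elim z z' a))) hSN
    rw [h0, hS0, add_zero] at hsum
    have hlt := Finset.card_lt_card (Finset.ssubset_iff_subset_ne.2 ⟨hSN, hS⟩)
    have hsd := Finset.card_sdiff_add_card_eq_card hSN
    have hSp := hSne.card_pos
    obtain ⟨p1, p2⟩ := ih S.card (by omega) S rfl hS0
    obtain ⟨q1, q2⟩ := ih (N \ S).card (by omega) (N \ S) rfl hsum
    have hL : N.toLeft.val = (N \ S).toLeft.val + S.toLeft.val := by
      rw [Finset.toLeft_sdiff, Finset.sdiff_val, tsub_add_cancel_of_le]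
      rw [Finset.val_le_iff]
      exact Finset.toLeft_subset_toLeft hSN
    have hR : N.toRight.val = (N \ S).toRight.val + S.toRight.val := by
      rw [Finset.toRight_sdiff, Finset.sdiff_val, tsub_add_cancel_of_le]
      rw [Finset.val_le_iff]
      exact Finset.toRight_subset_toRight hSN
    have hLc := congrArg Multiset.card hL
    have hRc := congrArg Multiset.card hR
    simp only [Multiset.card_add, Finset.card_val] at hLc hRc
    refine ⟨by omega, fun he => ?_⟩
    rw [hL, hR, Multiset.map_add, Multiset.map_add, p2 (by omega), q2 (by omega)]

theorem kr_perm {α τ : Type*} [Fintype α] (f g : α → τ)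
    (h : (Finset.univ : Finset α).val.map f = (Finset.univ : Finset α).val.map g) :
    ∃ σ : Equiv.Perm α, ∀ a, g a = f (σ a) := by
  classical
  have hc : ∀ t : τ, Nonempty ({a // g a = t} ≃ {a // f a = t}) := by
    intro t
    rw [← Fintype.card_eq, Fintype.card_subtype, Fintype.card_subtype]
    have h1 := congrArg (Multiset.count t) h
    rw [Multiset.count_map, Multiset.count_map] at h1
    simp only [eq_comm (a := t)] at h1
    exact h1.symm
  let e : ∀ t : τ, {a // g a = t} ≃ {a // f a = t} := fun t => (hc t).some
  refine ⟨(Equiv.sigmaFiberEquiv g).symm.trans ((Equiv.sigmaCongrRight e).trans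
    (Equiv.sigmaFiberEquiv f)), fun a => ?_⟩
  exact ((e (g a)) ⟨a, rfl⟩).2.symm

/-- coordinates of a triple tensor -/
noncomputable def krCoord (I J K : ℕ) : Basis (Fin I × Fin J × Fin K) 𝕂
    ((Fin I → 𝕂) ⊗[𝕂] ((Fin J → 𝕂) ⊗[𝕂] (Fin K → 𝕂))) :=
  (Pi.basisFun 𝕂 (Fin I)).tensorProduct ((Pi.basisFun 𝕂 (Fin J)).tensorProduct
    (Pi.basisFun 𝕂 (Fin K)))

theorem krCoord_repr {I J K : ℕ} (x : Fin I → 𝕂) (y : Fin J → 𝕂) (z : Fin K → 𝕂)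
    (i : Fin I) (j : Fin J) (k : Fin K) :
    (krCoord I J K).repr (x ⊗ₜ[𝕂] (y ⊗ₜ[𝕂] z)) (i, j, k) = x i * y j * z k := by
  simp [krCoord]
  ring

theorem kr_scale {I J K : ℕ} (x x' : Fin I → 𝕂) (y y' : Fin J → 𝕂) (z z' : Fin K → 𝕂)
    (hx : x ≠ 0) (hy : y ≠ 0) (hz : z ≠ 0)
    (h : ∀ i j k, x' i * y' j * z' k = x i * y j * z k) :
    ∃ a b c : 𝕂, a * b * c = 1 ∧ (∀ i, x' i = x i * a) ∧ (∀ j, y' j = y j * b) ∧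
      (∀ k, z' k = z k * c) := by
  obtain ⟨i, hi⟩ := Function.ne_iff.1 hx
  obtain ⟨j, hj⟩ := Function.ne_iff.1 hy
  obtain ⟨k, hk⟩ := Function.ne_iff.1 hz
  simp only [Pi.zero_apply] at hi hj hk
  have h0 := h i j k
  have hne : x' i * y' j * z' k ≠ 0 := by
    rw [h0]; exact mul_ne_zero (mul_ne_zero hi hj) hk
  have hk' : z' k ≠ 0 := right_ne_zero_of_mul hne
  have hj' : y' j ≠ 0 := right_ne_zero_of_mul (left_ne_zero_of_mul hne)
  have hi' : x' i ≠ 0 := left_ne_zero_of_mul (left_ne_zero_of_mul hne)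
  refine ⟨x' i / x i, y' j / y j, z' k / z k, ?_, ?_, ?_, ?_⟩
  · field_simp
    exact h0
  · intro p
    have := h p j k
    rw [← mul_div_assoc, eq_div_iff hi]
    apply mul_right_cancel₀ (mul_ne_zero hj' hk')
    apply mul_right_cancel₀ (mul_ne_zero hj hk)
    linear_combination (x i * y j * z k) * this - (x p * y j * z k) * h0
  · intro p
    have := h i p k
    rw [← mul_div_assoc, eq_div_iff hj]
    apply mul_right_cancel₀ (mul_ne_zero hi' hk')
    apply mul_right_cancel₀ (mul_ne_zero hi hk)
    linear_combination (x i * y j * z k) * this - (x i * y p * z k) * h0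
  · intro p
    have := h i j p
    rw [← mul_div_assoc, eq_div_iff hk]
    apply mul_right_cancel₀ (mul_ne_zero hi' hj')
    apply mul_right_cancel₀ (mul_ne_zero hi hj)
    linear_combination (x i * y j * z k) * this - (x i * y j * z p) * h0

/-- rank-one terms agree up to a permutation -/
theorem kr_pd {I J K R R' : ℕ} (A : Matrix (Fin I) (Fin R) 𝕂) (B : Matrix (Fin J) (Fin R) 𝕂)
    (C : Matrix (Fin K) (Fin R) 𝕂) (A' : Matrix (Fin I) (Fin R') 𝕂)
    (B' : Matrix (Fin J) (Fin R') 𝕂) (C' : Matrix (Fin K) (Fin R') 𝕂)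
    (hA : ∀ r, (fun i => A i r) ≠ 0) (hB : ∀ r, (fun i => B i r) ≠ 0) (hC : ∀ r, (fun i => C i r) ≠ 0)
    (hB' : ∀ r, (fun i => B' i r) ≠ 0) (hC' : ∀ r, (fun i => C' i r) ≠ 0)
    (H : ∀ S : Finset (Fin R), 2 ≤ S.card → 2 * S.card + 2 ≤
      finrank 𝕂 (span 𝕂 ((fun r i => A i r) '' S)) + finrank 𝕂 (span 𝕂 ((fun r i => B i r) '' S)) +
      finrank 𝕂 (span 𝕂 ((fun r i => C i r) '' S)))
    (h : ∀ i j k, ∑ r, A i r * B j r * C k r = ∑ r, A' i r * B' j r * C' k r) :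
    R ≤ R' ∧ (R = R' → 
      (Finset.univ : Finset (Fin R)).val.map
        (fun r => (fun i => A i r) ⊗ₜ[𝕂] ((fun i => B i r) ⊗ₜ[𝕂] (fun i => C i r))) =
      (Finset.univ : Finset (Fin R')).val.map
        (fun r => (fun i => A' i r) ⊗ₜ[𝕂] ((fun i => B' i r) ⊗ₜ[𝕂] (fun i => C' i r)))) := by
  have key := kr_main (fun r i => A i r) (fun r i => B i r) (fun r i => C i r) (fun r i => A' i r) (fun r i => B' i r) (fun r i => C' i r)
    hA hB hC hB' hC' H _ (Finset.univ.disjSum Finset.univ) rfl (by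
      rw [Finset.sum_disjSum]
      simp only [Sum.elim_inl, Sum.elim_inr, TensorProduct.neg_tmul, Finset.sum_neg_distrib]
      rw [← sub_eq_add_neg, sub_eq_zero]
      apply (krCoord I J K).ext_elem
      rintro ⟨i, j, k⟩
      simp only [map_sum, Finsupp.finsetSum_apply, krCoord_repr]
      exact h i j k)
  simpa using key
end KruskalMain

section KruskalRanks

theorem kr_card_le {I R : ℕ} (A : Matrix (Fin I) (Fin R) F) (S : Finset (Fin R)) :
    min S.card (krank A) ≤ finrank F (span F ((fun r i => A i r) '' S)) := by
  have hmem : krank A ∈ {k | k ≤ R ∧ ∀ s : Finset (Fin R), s.card = k →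
      LinearIndependent F (fun r : {x // x ∈ s} => A.transpose r.1)} := by
    apply Nat.sSup_mem
    · refine ⟨0, Nat.zero_le _, fun s hs => ?_⟩
      rw [Finset.card_eq_zero] at hs
      subst hs
      exact linearIndependent_empty_type
    · exact ⟨R, fun k hk => hk.1⟩
  obtain ⟨hk, hli⟩ := hmem
  have aux : ∀ s : Finset (Fin R), LinearIndependent F (fun r : {x // x ∈ s} => A.transpose r.1) →
      s ⊆ S → s.card ≤ finrank F (span F ((fun r i => A i r) '' S)) := by
    intro s hs hsub
    have h1 := finrank_span_eq_card hs
    rw [Fintype.card_coe] at h1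
    rw [← h1]
    apply Submodule.finrank_mono
    apply span_mono
    rintro _ ⟨a, rfl⟩
    exact ⟨a, hsub a.2, rfl⟩
  rcases le_total S.card (krank A) with h | h
  · rw [min_eq_left h]
    obtain ⟨t, hSt, _, ht⟩ := Finset.exists_subsuperset_card_eq (Finset.subset_univ S) h
      (by simpa using hk)
    have := hli t ht
    exact aux S (this.comp (fun a : {x // x ∈ S} => (⟨a.1, hSt a.2⟩ : {x // x ∈ t}))
      (fun a b hab => Subtype.ext (Subtype.mk.inj hab))) subset_rfl
  · rw [min_eq_right h]
    obtain ⟨t, htS, ht⟩ := Finset.exists_subset_card_eq h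
    have := aux t (hli t ht) htS
    omega

theorem kr_rank_le {I R : ℕ} (A : Matrix (Fin I) (Fin R) F) (S : Finset (Fin R)) :
    A.rank + S.card ≤ finrank F (span F ((fun r i => A i r) '' S)) + R := by
  classical
  rw [Matrix.rank_eq_finrank_span_cols]
  have h1 : span F (Set.range A.col) =
      span F ((fun r i => A i r) '' S) ⊔ span F ((fun r i => A i r) '' (Sᶜ : Finset (Fin R))) := by
    rw [← span_union, ← Set.image_union, Finset.coe_compl, Set.union_compl_self, Set.image_univ]
    rfl
  have h2 := Submodule.finrank_add_le_finrank_add_finrank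
    (span F ((fun r i => A i r) '' (S : Set (Fin R))))
    (span F ((fun r i => A i r) '' ((Sᶜ : Finset (Fin R)) : Set (Fin R))))
  have h3 : finrank F (span F ((fun r i => A i r) '' ((Sᶜ : Finset (Fin R)) : Set (Fin R)))) ≤
      (Sᶜ).card := by
    rw [← Finset.coe_image]
    exact (finrank_span_finset_le_card _).trans Finset.card_image_le
  have h4 := Finset.card_add_card_compl S
  rw [Fintype.card_fin] at h4
  rw [h1]
  omega

end KruskalRanks

/-- Corollary 1.20: Kruskal-type uniqueness condition for some cyclic
permutation (X,Y,Z) of (A,B,C). -/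
theorem stmt_9 {I J K R : ℕ} (T : Fin I → Fin J → Fin K → F)
    (A : Matrix (Fin I) (Fin R) F) (B : Matrix (Fin J) (Fin R) F) (C : Matrix (Fin K) (Fin R) F)
    (hPD : IsPD T A B C)
    (h : (krank A + B.rank + C.rank ≥ 2 * R + 2 ∧
            min (C.rank + krank B) (krank C + B.rank) ≥ R + 2) ∨
         (krank B + C.rank + A.rank ≥ 2 * R + 2 ∧
            min (A.rank + krank C) (krank A + C.rank) ≥ R + 2) ∨
         (krank C + A.rank + B.rank ≥ 2 * R + 2 ∧
            min (B.rank + krank A) (krank B + A.rank) ≥ R + 2)) :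
    tensorRank T = R ∧ CPDUnique T R := by
  classical
  have H : ∀ S : Finset (Fin R), 2 ≤ S.card → 2 * S.card + 2 ≤
      finrank F (span F ((fun r i => A i r) '' S)) +
      finrank F (span F ((fun r i => B i r) '' S)) +
      finrank F (span F ((fun r i => C i r) '' S)) := by
    intro S hS
    have a1 := kr_card_le A S
    have a2 := kr_rank_le A S
    have b1 := kr_card_le B S
    have b2 := kr_rank_le B S
    have c1 := kr_card_le C S
    have c2 := kr_rank_le C S
    omega
  obtain ⟨hA, hB, hC, hT⟩ := hPD
  have main : ∀ (R' : ℕ) (A' : Matrix (Fin I) (Fin R') F) (B' : Matrix (Fin J) (Fin R') F)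
      (C' : Matrix (Fin K) (Fin R') F), IsPD T A' B' C' → R ≤ R' ∧ (R = R' →
      (Finset.univ : Finset (Fin R)).val.map
        (fun r => (fun i => A i r) ⊗ₜ[F] ((fun i => B i r) ⊗ₜ[F] (fun i => C i r))) =
      (Finset.univ : Finset (Fin R')).val.map
        (fun r => (fun i => A' i r) ⊗ₜ[F] ((fun i => B' i r) ⊗ₜ[F] (fun i => C' i r)))) := by
    rintro R' A' B' C' ⟨hA', hB', hC', hT'⟩
    refine kr_pd A B C A' B' C' hA hB hC hB' hC' H ?_
    intro i j k
    rw [hT] at hT'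
    exact congrFun (congrFun (congrFun hT' i) j) k
  refine ⟨le_antisymm (Nat.sInf_le ⟨A, B, C, hA, hB, hC, hT⟩) ?_, ?_⟩
  · refine le_csInf (Set.nonempty_of_mem (x := R) ⟨A, B, C, hA, hB, hC, hT⟩) ?_
    rintro R' ⟨A', B', C', h'⟩
    exact (main R' A' B' C' h').1
  · intro A₁ A₂ B₁ B₂ C₁ C₂ h1 h2
    have e := ((main R A₁ B₁ C₁ h1).2 rfl).symm.trans ((main R A₂ B₂ C₂ h2).2 rfl)
    obtain ⟨σ, hσ⟩ := kr_perm _ _ e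
    have hs : ∀ r, ∃ a b c : F, a * b * c = 1 ∧ (∀ i, A₂ i r = A₁ i (σ r) * a) ∧
        (∀ j, B₂ j r = B₁ j (σ r) * b) ∧ (∀ k, C₂ k r = C₁ k (σ r) * c) := by
      intro r
      refine kr_scale (fun i => A₁ i (σ r)) (fun i => A₂ i r) (fun i => B₁ i (σ r))
        (fun i => B₂ i r) (fun i => C₁ i (σ r)) (fun i => C₂ i r)
        (h1.1 (σ r)) (h1.2.1 (σ r)) (h1.2.2.1 (σ r)) ?_
      intro i j k
      have := congrArg (fun t => (krCoord I J K).repr t (i, j, k)) (hσ r)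
      simpa only [krCoord_repr] using this
    choose la lb lc h1 h2 h3 h4 using hs
    exact ⟨σ, la, lb, lc, h1, fun i r => h2 r i, fun j r => h3 r j, fun k r => h4 r k⟩
end

section
/- Let A, Ā ∈ F^{I×R}, and for indices r₁,…,r_n ∈ {1,…,R} let E_{r₁…r_n} = span{a_{r₁},…,a_{r_n}} and Ē_{r₁…r_n} = span{ā_{r₁},…,ā_{r_n}}, where a_r, ā_r are the columns of A and Ā. Assume k_A ≥ 2 and that there exists m ∈ {2,…,k_A} such that E_{r₁…r_{m−1}} ⊆ Ē_{r₁…r_{m−1}} for all 1 ≤ r₁ < r₂ < ⋯ < r_{m−1} ≤ R. Then there exists a nonsingular R×R diagonal matrix Λ such that A = ĀΛ. -/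
open scoped Matrix
open MeasureTheory

variable {F : Type*} [RCLike F]

theorem krank_indep_aux {I R : ℕ} (A : Matrix (Fin I) (Fin R) F) :
    krank A ≤ R ∧ ∀ s : Finset (Fin R), s.card ≤ krank A →
      LinearIndepOn F A.transpose (s : Set (Fin R)) := by
  have hmem : krank A ∈ {k | k ≤ R ∧ ∀ s : Finset (Fin R), s.card = k →
    LinearIndependent F (fun r : {x // x ∈ s} => A.transpose r.1)} := by
    apply Nat.sSup_mem
    · refine ⟨0, Nat.zero_le _, ?_⟩
      intro s hs
      rw [Finset.card_eq_zero] at hs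
      subst hs
      have : IsEmpty {x // x ∈ (∅ : Finset (Fin R))} := ⟨fun x => Finset.notMem_empty _ x.2⟩
      exact linearIndependent_empty_type
    · exact ⟨R, fun k hk => hk.1⟩
  obtain ⟨h1, h2⟩ := hmem
  refine ⟨h1, fun s hs => ?_⟩
  obtain ⟨t, hst, ht⟩ := Finset.exists_superset_card_eq hs (by simpa using h1)
  have : LinearIndepOn F A.transpose (t : Set (Fin R)) := h2 t ht
  exact this.mono (by exact_mod_cast hst)

/-- Lemma 2.1: if the spans of all (m-1)-tuples of columns of `A` are
contained in the spans of the corresponding columns of `Ā`, then `A = ĀΛ`. -/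
theorem stmt_12 {I R : ℕ} (A Abar : Matrix (Fin I) (Fin R) F)
    (hk : 2 ≤ krank A) (m : ℕ) (hm2 : 2 ≤ m) (hmk : m ≤ krank A)
    (hspan : ∀ s : Finset (Fin R), s.card = m - 1 →
      Submodule.span F ((fun r => A.transpose r) '' ↑s) ≤
        Submodule.span F ((fun r => Abar.transpose r) '' ↑s)) :
    ∃ l : Fin R → F, (∀ r, l r ≠ 0) ∧ ∀ i r, A i r = Abar i r * l r := by
  classical
  obtain ⟨hKR, hind⟩ := krank_indep_aux A
  have hdim : ∀ s : Finset (Fin R), s.card = m - 1 →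
      Module.finrank F (Submodule.span F ((fun r => A.transpose r) '' (s : Set (Fin R)))) = m - 1 := by
    intro s hs
    have h := hind s (by omega)
    have h' : LinearIndependent F (fun r : s => A.transpose r.1) := h
    have h3 := finrank_span_eq_card h'
    rw [Fintype.card_coe, hs] at h3
    rw [← h3, Set.image_eq_range]
    rfl
  have hle : ∀ s : Finset (Fin R),
      Module.finrank F (Submodule.span F ((fun r => Abar.transpose r) '' (s : Set (Fin R)))) ≤ s.card := by
    intro s
    rw [← Finset.coe_image]
    exact (finrank_span_finset_le_card _).trans Finset.card_image_le
  have hrev : ∀ s : Finset (Fin R), s.card = m - 1 →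
      Submodule.span F ((fun r => A.transpose r) '' (s : Set (Fin R))) =
        Submodule.span F ((fun r => Abar.transpose r) '' (s : Set (Fin R))) := by
    intro s hs
    apply Submodule.eq_of_le_of_finrank_le (hspan s hs)
    rw [hdim s hs, ← hs]
    exact hle s
  have key : ∀ r, ∃ c : F, c ≠ 0 ∧ Abar.transpose r = c • A.transpose r := by
    intro r
    obtain ⟨t, hrt, ht⟩ := Finset.exists_superset_card_eq (s := {r}) (n := m)
      (by simp; omega) (by simp; omega)
    have hr : r ∈ t := hrt (by simp)
    -- coefficients
    have hco : ∀ k ∈ t, k ≠ r → ∃ c : Fin R → F, c k = 0 ∧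
        ∑ i ∈ t, c i • A.transpose i = Abar.transpose r := by
      intro k hkt hkr
      have h1 : Abar.transpose r ∈ Submodule.span F
          ((fun r => A.transpose r) '' ((t.erase k : Finset (Fin R)) : Set (Fin R))) := by
        rw [hrev _ (by rw [Finset.card_erase_of_mem hkt, ht])]
        exact Submodule.subset_span ⟨r, by simp [hr, hkr.symm], rfl⟩
      rw [Submodule.mem_span_image_finset_iff_exists_fun'] at h1
      obtain ⟨c, hc⟩ := h1
      refine ⟨fun i => if i = k then 0 else c i, by simp, ?_⟩
      rw [← hc, ← Finset.add_sum_erase t _ hkt]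
      simp only [if_true, zero_smul, zero_add]
      apply Finset.sum_congr rfl
      intro i hi
      rw [if_neg (Finset.ne_of_mem_erase hi)]
    obtain ⟨k0, hk0, hk0r⟩ := Finset.exists_mem_ne (s := t) (by omega) r
    obtain ⟨c, hc0, hc⟩ := hco k0 hk0 hk0r
    have hz : ∀ k ∈ t, k ≠ r → c k = 0 := by
      intro k hkt hkr
      obtain ⟨d, hd0, hd⟩ := hco k hkt hkr
      have hl := hind t (by omega)
      replace hl := linearIndepOn_finset_iff.1 hl
      have := hl (fun i => c i - d i) (by
        simp only [sub_smul, Finset.sum_sub_distrib, hc, hd, sub_self]) k hkt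
      simpa [hd0] using this
    refine ⟨c r, ?_, ?_⟩
    rotate_left
    · rw [← hc]
      apply Finset.sum_eq_single_of_mem r hr
      intro b hb hbr
      rw [hz b hb hbr, zero_smul]
    · intro hcr
      have h0 : Abar.transpose r = 0 := by
        rw [← hc]
        apply Finset.sum_eq_zero
        intro b hb
        by_cases hbr : b = r
        · rw [hbr, hcr, zero_smul]
        · rw [hz b hb hbr, zero_smul]
      have hs : (t.erase k0).card = m - 1 := by rw [Finset.card_erase_of_mem hk0, ht]
      have hrs : r ∈ t.erase k0 := Finset.mem_erase.2 ⟨hk0r.symm, hr⟩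
      have h1 := hdim _ hs
      rw [hrev _ hs, ← Finset.insert_erase hrs, Finset.coe_insert, Set.image_insert_eq, h0,
        Submodule.span_insert_zero] at h1
      have h2 := hle ((t.erase k0).erase r)
      rw [h1, Finset.card_erase_of_mem hrs, hs] at h2
      omega
  choose c hc0 hc using key
  refine ⟨fun r => (c r)⁻¹, fun r => inv_ne_zero (hc0 r), fun i r => ?_⟩
  have h : Abar i r = c r * A i r := congrFun (hc r) i
  rw [h, mul_comm (c r), mul_assoc, mul_inv_cancel₀ (hc0 r), mul_one]
end

section
/- Let C ∈ F^{K×R} and let m be an integer with m ≤ k_C. Then for any set of m−1 distinct indices I = {i₁,…,i_{m−1}} ⊆ {1,…,R} there exists a vector x ∈ F^K such that x^T c_i = 0 for all i ∈ I and x^T c_i ≠ 0 for all i ∈ {1,…,R} \ I, where c_i denotes the i-th column of C. -/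
open scoped Matrix
open MeasureTheory

variable {F : Type*} [RCLike F]

/-- Lemma 2.2: existence of a vector orthogonal to a given set of `m-1`
columns of `C` and non-orthogonal to all the others. -/
theorem stmt_13 {K R : ℕ} (C : Matrix (Fin K) (Fin R) F)
    (m : ℕ) (hm : m ≤ krank C)
    (s : Finset (Fin R)) (hs : s.card + 1 = m) :
    ∃ x : Fin K → F, (∀ i ∈ s, Matrix.vecMul x C i = 0) ∧
      ∀ i ∉ s, Matrix.vecMul x C i ≠ 0 := by
  classical
  have hmem := Nat.sSup_mem (s := {k | k ≤ R ∧ ∀ s : Finset (Fin R), s.card = k →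
      LinearIndependent F (fun r : {x // x ∈ s} => C.transpose r.1)})
    ⟨0, Nat.zero_le _, fun t ht => by
      obtain rfl := Finset.card_eq_zero.mp ht
      have : IsEmpty {x : Fin R // x ∈ (∅ : Finset (Fin R))} := ⟨fun x => Finset.notMem_empty x.1 x.2⟩
      exact linearIndependent_empty_type⟩
    ⟨R, fun k hk => hk.1⟩
  obtain ⟨hkR, hind⟩ := hmem
  change krank C ≤ R at hkR
  have key : ∀ i, i ∉ s → C.transpose i ∉ Submodule.span F (C.transpose '' (s : Set (Fin R))) := by
    intro i hi
    have hc : (insert i s).card = m := by rw [Finset.card_insert_of_notMem hi, hs]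
    obtain ⟨t, hst, htc⟩ := Finset.exists_superset_card_eq (s := insert i s) (n := krank C)
      (by omega) (by simpa using hkR)
    have h1 : LinearIndepOn F C.transpose (t : Set (Fin R)) := hind t htc
    have h2 : LinearIndepOn F C.transpose (insert i (s : Set (Fin R))) :=
      h1.mono (by rw [← Finset.coe_insert]; exact_mod_cast hst)
    exact ((linearIndepOn_insert (by simpa using hi)).mp h2).2
  let W := Submodule.span F (C.transpose '' (s : Set (Fin R)))
  obtain ⟨f, hf⟩ := Module.exists_dual_forall_apply_ne_zero (K := F)
    (fun i : {i : Fin R // i ∉ s} => W.mkQ (C.transpose i.1)) (fun i => by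
      simpa [W] using key i.1 i.2)
  let g : (Fin K → F) →ₗ[F] F := f ∘ₗ W.mkQ
  have hg : ∀ i, Matrix.vecMul (fun k => g (Pi.single k 1)) C i = g (C.transpose i) := by
    intro i
    rw [LinearMap.pi_apply_eq_sum_univ g (C.transpose i)]
    simp only [Matrix.vecMul, dotProduct, Matrix.transpose_apply, smul_eq_mul]
    refine Finset.sum_congr rfl fun k _ => ?_
    rw [mul_comm]
    congr 2
    ext j
    simp [Pi.single_apply, eq_comm]
  refine ⟨fun k => g (Pi.single k 1), fun i hi => ?_, fun i hi => ?_⟩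
  · rw [hg]
    have : W.mkQ (C.transpose i) = 0 := by
      rw [Submodule.mkQ_apply, Submodule.Quotient.mk_eq_zero]
      exact Submodule.subset_span ⟨i, by simpa using hi, rfl⟩
    simp only [g, LinearMap.comp_apply, this, map_zero]
  · rw [hg]
    exact hf ⟨i, hi⟩
end
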